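/- arXiv:2104.05958 — 2 statements merged into one kernel-verified Lean document; each statement's English description precedes it below -/
import Mathlib

section
/- If T is a tree, then ch'_star(T) ≤ ⌊(θ(T) + Δ(T))/2⌋, where θ(T) = max over edges xy of T of (d(x) + d(y)) is the maximum Ore-degree and Δ(T) is the maximum degree. -/
open SimpleGraph
open scoped Classical

/-- Two edges (as unordered pairs of vertices) are adjacent:
they are distinct and share an endpoint. -/
def EdgeAdj {V : Type*} (e₁ e₂ : Sym2 V) : Prop :=
  e₁ ≠ e₂ ∧ ∃ v, v ∈ e₁ ∧ v ∈ e₂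

/-- `φ` is a star edge coloring of `G`: a proper edge coloring such that
no path of length four and no cycle of length four is bichromatic. -/
def IsStarEdgeColoring {V : Type*} (G : SimpleGraph V) (φ : Sym2 V → ℕ) : Prop :=
  (∀ e₁ ∈ G.edgeSet, ∀ e₂ ∈ G.edgeSet, EdgeAdj e₁ e₂ → φ e₁ ≠ φ e₂) ∧
  (∀ (u v : V) (p : G.Walk u v), p.IsPath → p.length = 4 →
      ¬ ∃ c₁ c₂ : ℕ, ∀ e ∈ p.edges, φ e = c₁ ∨ φ e = c₂) ∧
  (∀ (u : V) (p : G.Walk u u), p.IsCycle → p.length = 4 →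
      ¬ ∃ c₁ c₂ : ℕ, ∀ e ∈ p.edges, φ e = c₁ ∨ φ e = c₂)

/-- `G` has a star edge coloring using colors `< k`. -/
def StarColorable {V : Type*} (G : SimpleGraph V) (k : ℕ) : Prop :=
  ∃ φ : Sym2 V → ℕ, (∀ e ∈ G.edgeSet, φ e < k) ∧ IsStarEdgeColoring G φ

/-- The star chromatic index of `G`. -/
noncomputable def starChromaticIndex {V : Type*} (G : SimpleGraph V) : ℕ :=
  sInf {k | StarColorable G k}

/-- `G` is star `k`-edge choosable. -/
def StarChoosable {V : Type*} (G : SimpleGraph V) (k : ℕ) : Prop :=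
  ∀ L : Sym2 V → Finset ℕ, (∀ e ∈ G.edgeSet, k ≤ (L e).card) →
    ∃ φ : Sym2 V → ℕ, (∀ e ∈ G.edgeSet, φ e ∈ L e) ∧ IsStarEdgeColoring G φ

/-- The list star chromatic index of `G`. -/
noncomputable def listStarChromaticIndex {V : Type*} (G : SimpleGraph V) : ℕ :=
  sInf {k | StarChoosable G k}

/-- The maximum Ore-degree `θ(G) = max_{xy ∈ E(G)} (d(x) + d(y))`. -/
noncomputable def oreDegree {V : Type*} (G : SimpleGraph V) [Fintype V] : ℕ :=
  sSup {n | ∃ x y, G.Adj x y ∧ n = G.degree x + G.degree y}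

/-- `H = T ∪ C` is a generalized Halin graph with characteristic tree `T` and
adjoint cycle `C`: `T` is a tree with `Δ(T) ≥ 3`, `C` is a cycle (a connected
`2`-regular subgraph on its support) passing exactly through the leaves of `T`,
the edges of `T` and `C` are disjoint, and `H` is their union. -/
def IsGenHalin {V : Type*} [Fintype V] (H T C : SimpleGraph V) : Prop :=
  T.IsTree ∧ 3 ≤ T.maxDegree ∧ H = T ⊔ C ∧ Disjoint T.edgeSet C.edgeSet ∧
  (∀ v, T.degree v = 1 ↔ C.degree v = 2) ∧
  (∀ v, C.degree v = 0 ∨ C.degree v = 2) ∧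
  (∀ u v, C.degree u = 2 → C.degree v = 2 → C.Reachable u v)

/-- A Halin graph: a generalized Halin graph whose characteristic tree has
no vertex of degree `2`. -/
def IsHalin {V : Type*} [Fintype V] (H T C : SimpleGraph V) : Prop :=
  IsGenHalin H T C ∧ ∀ v, T.degree v ≠ 2

/-- A complete Halin graph: all leaves of `T` are at the same distance
from the root. -/
def IsCompleteHalin {V : Type*} [Fintype V] (H T C : SimpleGraph V) : Prop :=
  IsHalin H T C ∧
    ∃ r, ∀ u v, T.degree u = 1 → T.degree v = 1 → T.dist r u = T.dist r v

/-- Greedy choice of distinct representatives. -/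
lemma exists_injOn_choice {V : Type*} (W : Finset V) (A : V → Finset ℕ)
    (h : ∀ w ∈ W, W.card ≤ (A w).card) :
    ∃ g : V → ℕ, (∀ w ∈ W, g w ∈ A w) ∧ Set.InjOn g W := by
  induction W using Finset.induction_on with
  | empty => exact ⟨fun _ => 0, by simp, by simp⟩
  | insert a s ha ih =>
    rw [Finset.card_insert_of_notMem ha] at h
    obtain ⟨g, hg, hi⟩ := ih (fun w hw => by
      have := h w (Finset.mem_insert_of_mem hw); omega)
    have h1 : (s.image g).card < (A a).card := by
      have := h a (Finset.mem_insert_self _ _)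
      have := Finset.card_image_le (s := s) (f := g)
      omega
    obtain ⟨c, hc, hc'⟩ := Finset.exists_mem_notMem_of_card_lt_card h1
    have hne : ∀ x ∈ s, x ≠ a := fun x hx e => ha (e ▸ hx)
    have hgc : ∀ x ∈ s, g x ≠ c := fun x hx e => hc' (Finset.mem_image.2 ⟨x, hx, e⟩)
    refine ⟨Function.update g a c, ?_, ?_⟩
    · intro w hw
      rcases Finset.mem_insert.1 hw with rfl | hw
      · simpa using hc
      · rw [Function.update_of_ne (hne w hw)]; exact hg w hw
    · intro x hx y hy hxy
      replace hx := Finset.mem_insert.1 (Finset.mem_coe.1 hx)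
      replace hy := Finset.mem_insert.1 (Finset.mem_coe.1 hy)
      rcases hx with rfl | hx <;> rcases hy with rfl | hy
      · rfl
      · rw [Function.update_self, Function.update_of_ne (hne y hy)] at hxy
        exact absurd hxy.symm (hgc y hy)
      · rw [Function.update_self, Function.update_of_ne (hne x hx)] at hxy
        exact absurd hxy (hgc x hx)
      · rw [Function.update_of_ne (hne x hx), Function.update_of_ne (hne y hy)] at hxy
        exact hi hx hy hxy

/-- The arcs of a nearly regular tournament on `{0, …, n - 1}`. -/
def Beats (n i j : ℕ) : Prop := (i < j ∧ 2 * (j - i) < n) ∨ (j < i ∧ n ≤ 2 * (i - j))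

lemma beats_card (n i : ℕ) (hi : i < n) :
    ((Finset.range n).filter (Beats n i)).card ≤ n / 2 ∧
    (i < n / 2 → ((Finset.range n).filter (Beats n i)).card + 1 ≤ (n + 1) / 2) := by
  have hsub : (Finset.range n).filter (Beats n i) ⊆
      Finset.Ioo i (min n (i + (n + 1) / 2)) ∪ Finset.range (i + 1 - (n + 1) / 2) := by
    intro j hj
    simp only [Finset.mem_filter, Finset.mem_range, Beats] at hj
    simp only [Finset.mem_union, Finset.mem_Ioo, Finset.mem_range]
    omega
  have h1 := Finset.card_le_card hsub
  have h2 := Finset.card_union_le (Finset.Ioo i (min n (i + (n + 1) / 2)))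
    (Finset.range (i + 1 - (n + 1) / 2))
  rw [Nat.card_Ioo, Finset.card_range] at h2
  constructor
  · omega
  · intro h; omega

/-- A nearly regular tournament on `W` whose lower out-degrees are on `B`. -/
lemma exists_tournament {V : Type*} (W B : Finset V) (hB : B ⊆ W) (hc : B.card ≤ W.card / 2) :
    ∃ O : V → Finset V, (∀ w ∈ W, O w ⊆ W ∧ w ∉ O w ∧
      (O w).card + (if w ∈ B then 1 else 0) ≤ (W.card + 1) / 2) ∧
      ∀ x ∈ W, ∀ y ∈ W, x ≠ y → y ∈ O x ∨ x ∈ O y := by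
  -- an indexing of W placing B first
  obtain ⟨f, hinj, hlt, hfB⟩ : ∃ f : V → ℕ, Set.InjOn f W ∧ (∀ w ∈ W, f w < W.card) ∧
      ∀ w ∈ B, f w < B.card := by
    let e1 := B.equivFin
    let e2 := (W \ B).equivFin
    have hcard : (W \ B).card + B.card = W.card := Finset.card_sdiff_add_card_eq_card hB
    refine ⟨fun v => if h : v ∈ B then (e1 ⟨v, h⟩ : ℕ) else
      if h : v ∈ W \ B then B.card + (e2 ⟨v, h⟩ : ℕ) else 0, ?_, ?_, ?_⟩
    · intro x hx y hy hxy
      have hx : x ∈ W := hx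
      have hy : y ∈ W := hy
      by_cases hxB : x ∈ B <;> by_cases hyB : y ∈ B
      · simp only [hxB, hyB, dite_true] at hxy
        have := e1.injective (Fin.ext hxy)
        simpa using this
      · have hy' : y ∈ W \ B := Finset.mem_sdiff.2 ⟨hy, hyB⟩
        simp only [hxB, hyB, hy', dite_true, dite_false] at hxy
        have := (e1 ⟨x, hxB⟩).2
        omega
      · have hx' : x ∈ W \ B := Finset.mem_sdiff.2 ⟨hx, hxB⟩
        simp only [hxB, hyB, hx', dite_true, dite_false] at hxy
        have := (e1 ⟨y, hyB⟩).2
        omega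
      · have hy' : y ∈ W \ B := Finset.mem_sdiff.2 ⟨hy, hyB⟩
        have hx' : x ∈ W \ B := Finset.mem_sdiff.2 ⟨hx, hxB⟩
        simp only [hxB, hyB, hx', hy', dite_true, dite_false] at hxy
        have := e2.injective (Fin.ext (Nat.add_left_cancel hxy))
        simpa using this
    · intro w hw
      by_cases hwB : w ∈ B
      · simp only [hwB, dite_true]
        have := (e1 ⟨w, hwB⟩).2
        omega
      · have hw' : w ∈ W \ B := Finset.mem_sdiff.2 ⟨hw, hwB⟩
        simp only [hwB, hw', dite_true, dite_false]
        have := (e2 ⟨w, hw'⟩).2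
        omega
    · intro w hwB
      simp only [hwB, dite_true]
      exact (e1 ⟨w, hwB⟩).2
  refine ⟨fun w => W.filter (fun y => Beats W.card (f w) (f y)), ?_, ?_⟩
  · intro w hw
    refine ⟨Finset.filter_subset _ _, ?_, ?_⟩
    · intro h
      have := (Finset.mem_filter.1 h).2
      simp only [Beats] at this
      omega
    · have hle : (W.filter (fun y => Beats W.card (f w) (f y))).card ≤
          ((Finset.range W.card).filter (Beats W.card (f w))).card := by
        apply Finset.card_le_card_of_injOn f
        · intro y hy
          have hy := Finset.mem_filter.1 hy
          exact Finset.mem_filter.2 ⟨Finset.mem_range.2 (hlt y hy.1), hy.2⟩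
        · exact hinj.mono (by intro y hy; exact (Finset.mem_filter.1 hy).1)
      have hb := beats_card W.card (f w) (hlt w hw)
      show (W.filter (fun y => Beats W.card (f w) (f y))).card + _ ≤ _
      split_ifs with h
      · have := hb.2 (by have := hfB w h; omega)
        omega
      · have := hb.1
        omega
  · intro x hx y hy hxy
    have hne : f x ≠ f y := fun e => hxy (hinj hx hy e)
    have : Beats W.card (f x) (f y) ∨ Beats W.card (f y) (f x) := by
      simp only [Beats]
      omega
    rcases this with h | h
    · exact Or.inl (Finset.mem_filter.2 ⟨hy, h⟩)
    · exact Or.inr (Finset.mem_filter.2 ⟨hx, h⟩)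

/-- The local extension step: colour the edges at a vertex with neighbourhood `N` whose edge to the
parent `u` has colour `a`. `P` is the set of other colours at `u`. -/
lemma local_step {V : Type*} (k : ℕ) (N : Finset V) (u : V) (hu : u ∈ N) (a : ℕ)
    (P F0 : Finset ℕ) (L : V → Finset ℕ) (d : V → ℕ)
    (hF0 : F0.card + N.card ≤ k) (hP : (P \ F0).card ≤ (N.card - 1) / 2)
    (hL : ∀ w ∈ N, k ≤ (L w).card)
    (h1 : ∀ w ∈ N, N.card + 2 * d w ≤ 2 * k + 1)
    (h2 : ∀ w ∈ N, 2 * N.card + d w ≤ 2 * k + 1) :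
    ∃ (g : V → ℕ) (F : V → Finset ℕ), g u = a ∧ Set.InjOn g N ∧
      (∀ w ∈ N, w ≠ u → g w ∈ L w ∧ g w ∉ F0 ∧ (g w ∈ P → a ∈ F w)) ∧
      (∀ w ∈ N, w ≠ u → (F w).card + d w ≤ k ∧
        (((N.erase w).image g) \ F w).card ≤ (d w - 1) / 2) ∧
      (∀ x ∈ N, x ≠ u → ∀ y ∈ N, y ≠ u → x ≠ y → g y ∈ F x ∨ g x ∈ F y) := by
  have hW : (N.erase u).card + 1 = N.card := Finset.card_erase_add_one hu
  obtain ⟨g0, hg0, hi0⟩ := exists_injOn_choice (N.erase u) (fun w => L w \ (insert a F0)) (by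
    intro w hw
    have := hL w (Finset.mem_of_mem_erase hw)
    have h3 := Finset.le_card_sdiff (insert a F0) (L w)
    have h4 := Finset.card_insert_le a F0
    omega)
  obtain ⟨g, hgu, hgw⟩ : ∃ g : V → ℕ, g u = a ∧ ∀ w, w ≠ u → g w = g0 w :=
    ⟨Function.update g0 u a, by simp, fun w hw => Function.update_of_ne hw _ _⟩
  have hg : ∀ w ∈ N, w ≠ u → g w ∈ L w ∧ g w ≠ a ∧ g w ∉ F0 := by
    intro w hw hne
    have := hg0 w (Finset.mem_erase.2 ⟨hne, hw⟩)
    rw [← hgw w hne] at this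
    simpa [not_or] using this
  have hinj : Set.InjOn g N := by
    intro x hx y hy hxy
    by_cases hxu : x = u <;> by_cases hyu : y = u
    · rw [hxu, hyu]
    · rw [hxu, hgu] at hxy; exact absurd hxy.symm (hg y hy hyu).2.1
    · rw [hyu, hgu] at hxy; exact absurd hxy (hg x hx hxu).2.1
    · rw [hgw x hxu, hgw y hyu] at hxy
      exact hi0 (by simpa [hxu] using hx) (by simpa [hyu] using hy) hxy
  set B := (N.erase u).filter (fun w => g w ∈ P) with hBdef
  have hBc : B.card ≤ (P \ F0).card := by
    apply Finset.card_le_card_of_injOn g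
    · intro w hw
      have hw := Finset.mem_filter.1 hw
      have hw1 := Finset.mem_erase.1 hw.1
      exact Finset.mem_sdiff.2 ⟨hw.2, (hg w hw1.2 hw1.1).2.2⟩
    · exact hinj.mono (by
        intro y hy; exact Finset.mem_of_mem_erase (Finset.mem_filter.1 hy).1)
  obtain ⟨O, hO, hT⟩ := exists_tournament (N.erase u) B (Finset.filter_subset _ _) (by omega)
  have key : ∀ w, ∃ F : Finset ℕ, w ∈ N → w ≠ u →
      (O w).image g ⊆ F ∧ (g w ∈ P → a ∈ F) ∧ F.card + d w ≤ k ∧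
        (((N.erase w).image g) \ F).card ≤ (d w - 1) / 2 := by
    intro w
    by_cases hw : w ∈ N ∧ w ≠ u
    swap
    · exact ⟨∅, fun h h' => absurd ⟨h, h'⟩ hw⟩
    obtain ⟨hw, hne⟩ := hw
    have hwW : w ∈ N.erase u := Finset.mem_erase.2 ⟨hne, hw⟩
    obtain ⟨hO1, hO2, hO3⟩ := hO w hwW
    set F1 := (O w).image g ∪ (if w ∈ B then {a} else ∅) with hF1
    have hF1c : F1.card ≤ ((N.erase u).card + 1) / 2 := by
      refine le_trans (Finset.card_union_le _ _) ?_
      have := Finset.card_image_le (s := O w) (f := g)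
      have h5 : (if w ∈ B then {a} else ∅ : Finset ℕ).card = if w ∈ B then 1 else 0 := by
        split_ifs <;> simp
      omega
    have hsub : F1 ⊆ (N.erase w).image g := by
      intro c hc
      rcases Finset.mem_union.1 hc with hc | hc
      · obtain ⟨y, hy, rfl⟩ := Finset.mem_image.1 hc
        refine Finset.mem_image_of_mem g (Finset.mem_erase.2 ⟨?_, Finset.mem_of_mem_erase (hO1 hy)⟩)
        rintro rfl
        exact hO2 hy
      · have : c = a := by
          split_ifs at hc with h
          · simpa using hc
          · simp at hc
        rw [this, ← hgu]
        exact Finset.mem_image_of_mem g (Finset.mem_erase.2 ⟨hne.symm, hu⟩)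
    have hcard : ((N.erase w).image g).card + 1 = N.card := by
      rw [Finset.card_image_of_injOn (hinj.mono (by simp)), Finset.card_erase_add_one hw]
    have e1 := h1 w hw
    have e2 := h2 w hw
    have hle := Finset.card_le_card hsub
    obtain ⟨F, hF1F, hFsub, hFc⟩ := Finset.exists_subsuperset_card_eq hsub
      (n := min (N.card - 1) (k - d w)) (by omega) (by omega)
    refine ⟨F, fun _ _ => ⟨Finset.union_subset_left hF1F, ?_, by omega, ?_⟩⟩
    · intro hgP
      apply hF1F
      have : w ∈ B := Finset.mem_filter.2 ⟨hwW, hgP⟩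
      simp [hF1, this]
    · rw [Finset.card_sdiff_of_subset hFsub]
      omega
  choose F hF using key
  refine ⟨g, F, hgu, hinj, ?_, ?_, ?_⟩
  · intro w hw hne
    exact ⟨(hg w hw hne).1, (hg w hw hne).2.2, (hF w hw hne).2.1⟩
  · intro w hw hne
    exact (hF w hw hne).2.2
  · intro x hx hxu y hy hyu hxy
    rcases hT x (Finset.mem_erase.2 ⟨hxu, hx⟩) y (Finset.mem_erase.2 ⟨hyu, hy⟩) hxy with h | h
    · exact Or.inl ((hF x hx hxu).1 (Finset.mem_image_of_mem g h))
    · exact Or.inr ((hF y hy hyu).1 (Finset.mem_image_of_mem g h))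

/-- Parent function of a tree rooted at `r`. -/
lemma exists_parent {V : Type*} (T : SimpleGraph V) (hT : T.IsTree) (r : V) :
    ∃ (par : V → V) (dep : V → ℕ), par r = r ∧
      (∀ v, v ≠ r → T.Adj (par v) v ∧ dep (par v) < dep v) ∧
      ∀ x y, T.Adj x y → (x ≠ r ∧ par x = y) ∨ (y ≠ r ∧ par y = x) := by
  choose f hf hf' using (hT.existsUnique_path · r)
  have hfr : f r = Walk.nil := (hf' r Walk.nil Walk.IsPath.nil).symm
  refine ⟨fun v => (f v).snd, fun v => (f v).length, ?_, ?_, ?_⟩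
  · simp [hfr]
  · intro v hv
    have hn : ¬ (f v).Nil := Walk.not_nil_of_ne hv
    refine ⟨((f v).adj_snd hn).symm, ?_⟩
    have h1 := hf' _ (f v).tail (hf v).tail
    have h2 := Walk.length_tail_add_one hn
    rw [h1] at h2
    show (f (f v).snd).length < (f v).length
    omega
  · intro x y hxy
    by_cases hy : y ∈ (f x).support
    · left
      refine ⟨?_, (hT.isAcyclic.eq_snd_of_adj_start (hf x) hxy hy).symm⟩
      rintro rfl
      rw [hfr] at hy
      simp at hy
      exact hxy.ne hy.symm
    · right
      have h1 := hf' y (Walk.cons hxy.symm (f x)) ((Walk.cons_isPath_iff _ _).2 ⟨hf x, hy⟩)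
      refine ⟨?_, ?_⟩
      · rintro rfl
        exact hy (Walk.end_mem_support _)
      · show (f y).snd = x
        rw [← h1]
        simp

/-- Dependent choice down a rooted tree. -/
lemma tree_choice {V S : Type*} (r : V) (par : V → V) (dep : V → ℕ)
    (hdep : ∀ v, v ≠ r → dep (par v) < dep v) (Good : V → S → Prop) (R : V → S → S → Prop)
    (hr : ∃ s, Good r s)
    (hstep : ∀ v, v ≠ r → ∀ s, Good (par v) s → ∃ t, Good v t ∧ R v s t) :
    ∃ st : V → S, (∀ v, Good v (st v)) ∧ ∀ v, v ≠ r → R v (st (par v)) (st v) := by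
  obtain ⟨s0, hs0⟩ := hr
  have : ∀ v s, ∃ t, v ≠ r → Good (par v) s → Good v t ∧ R v s t := by
    intro v s
    by_cases h : v ≠ r ∧ Good (par v) s
    · obtain ⟨t, ht⟩ := hstep v h.1 s h.2
      exact ⟨t, fun _ _ => ht⟩
    · exact ⟨s0, fun h1 h2 => absurd ⟨h1, h2⟩ h⟩
  choose nx hnx using this
  have hwf : WellFounded (fun x y : V => dep x < dep y) := (measure dep).wf
  let st : V → S := hwf.fix (fun v ih => if h : v ≠ r then nx v (ih (par v) (hdep v h)) else s0)
  have hst : ∀ v, st v = if v ≠ r then nx v (st (par v)) else s0 := by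
    intro v
    show hwf.fix _ v = _
    rw [hwf.fix_eq]
    by_cases h : v = r
    · simp [h]
    · simp only [ne_eq, h, not_false_eq_true, dite_true, if_true]
      rfl
  have hgood : ∀ v, Good v (st v) := by
    intro v
    induction v using hwf.induction with
    | _ v ih =>
      rw [hst]
      split_ifs with h
      · exact (hnx v _ h (ih (par v) (hdep v h))).1
      · simp only [ne_eq, not_not] at h
        rw [h]; exact hs0
  refine ⟨st, hgood, fun v hv => ?_⟩
  have := (hnx v _ hv (hgood (par v))).2
  rw [hst v, if_pos hv]
  exact this

/-- The choosability statement. -/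
lemma starChoosable_tree {V : Type*} [Fintype V] (T : SimpleGraph V) (hT : T.IsTree)
    [Nontrivial V] (k : ℕ)
    (hk : ∀ x y, T.Adj x y → T.degree x + 2 * T.degree y ≤ 2 * k + 1) : StarChoosable T k := by
  intro L hL
  obtain ⟨r, hr⟩ := hT.exists_vert_degree_one_of_nontrivial
  obtain ⟨par, dep, hparr, hpar, hadj⟩ := exists_parent T hT r
  have hor : ∀ x y, T.Adj x y → y ≠ par x → y ≠ r ∧ par y = x := by
    intro x y h hne
    rcases hadj x y h with h' | h'
    · exact absurd h'.2.symm hne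
    · exact h'
  have hpp : ∀ v, v ≠ r → v ≠ par (par v) := by
    intro v hv e
    have h1 := (hpar v hv).2
    by_cases h : par v = r
    · rw [h, hparr] at e; exact hv e
    · have h2 := (hpar _ h).2
      rw [← e] at h2
      omega
  obtain ⟨st, hG, hR⟩ := tree_choice (S := (V → ℕ) × (V → Finset ℕ)) r par dep
    (fun v hv => (hpar v hv).2)
    (fun v s => Set.InjOn s.1 (T.neighborFinset v) ∧
      (∀ w, T.Adj v w → w ≠ par v → s.1 w ∈ L s(v, w) ∧ (s.2 w).card + T.degree w ≤ k ∧
        ((((T.neighborFinset v).erase w).image s.1) \ s.2 w).card ≤ (T.degree w - 1) / 2) ∧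
      (∀ x y, T.Adj v x → x ≠ par v → T.Adj v y → y ≠ par v → x ≠ y →
        s.1 y ∈ s.2 x ∨ s.1 x ∈ s.2 y))
    (fun v s t => t.1 (par v) = s.1 v ∧ ∀ w, T.Adj v w → w ≠ par v → t.1 w ∉ s.2 v ∧
      (t.1 w ∈ ((T.neighborFinset (par v)).erase v).image s.1 → s.1 v ∈ t.2 w))
    (by
      obtain ⟨v, hv⟩ := Finset.card_eq_one.1 hr
      have hmem : ∀ w, T.Adj r w → w = v := by
        intro w hw
        have : w ∈ T.neighborFinset r := (T.mem_neighborFinset r w).2 hw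
        rw [hv] at this
        simpa using this
      have hrv : T.Adj r v := by
        rw [← T.mem_neighborFinset, hv]; simp
      have hk1 := hk r v hrv
      rw [hr] at hk1
      have hvpos : 0 < T.degree v := (T.degree_pos_iff_exists_adj v).2 ⟨r, hrv.symm⟩
      have : 0 < (L s(r, v)).card := by
        have := hL s(r, v) hrv
        omega
      obtain ⟨c, hc⟩ := Finset.card_pos.1 this
      refine ⟨(fun _ => c, fun _ => ∅), ?_, ?_, ?_⟩
      · rw [hv]; simp
      · intro w hw _
        obtain rfl := hmem w hw
        refine ⟨hc, ?_, ?_⟩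
        · simp; omega
        · rw [hv]; simp
      · intro x y hx _ hy _ hxy
        exact absurd ((hmem x hx).trans (hmem y hy).symm) hxy)
    (by
      rintro v hv ⟨g, F⟩ ⟨hi, hs, -⟩
      have hpv := (hpar v hv).1
      obtain ⟨-, hs2, hs3⟩ := hs v hpv (hpp v hv)
      obtain ⟨g', F', e1, e2, e3, e4, e5⟩ := local_step k (T.neighborFinset v) (par v)
        ((T.mem_neighborFinset _ _).2 hpv.symm) (g v)
        (((T.neighborFinset (par v)).erase v).image g) (F v) (fun w => L s(v, w))
        (fun w => T.degree w)
        hs2 hs3 (fun w hw => hL _ ((T.mem_neighborFinset _ _).1 hw))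
        (fun w hw => hk v w ((T.mem_neighborFinset _ _).1 hw))
        (fun w hw => by
          have := hk w v ((T.mem_neighborFinset _ _).1 hw).symm
          rw [T.card_neighborFinset_eq_degree]; omega)
      simp only [T.mem_neighborFinset] at e3 e4 e5
      refine ⟨(g', F'), ⟨e2, ?_, ?_⟩, e1, ?_⟩
      · intro w hw hne
        exact ⟨(e3 w hw hne).1, e4 w hw hne⟩
      · intro x y hx hxp hy hyp hxy
        exact e5 x hx hxp y hy hyp hxy
      · intro w hw hne
        exact (e3 w hw hne).2)
  have hsymm : ∀ x y, T.Adj x y → (st x).1 y = (st y).1 x := by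
    intro x y hxy
    rcases hadj x y hxy with ⟨h, rfl⟩ | ⟨h, rfl⟩
    · exact (hR x h).1
    · exact (hR y h).1.symm
  obtain ⟨φ, hφ⟩ : ∃ φ : Sym2 V → ℕ, ∀ x y, T.Adj x y → φ s(x, y) = (st x).1 y := by
    refine ⟨fun e => (st (Quot.out e).1).1 (Quot.out e).2, fun x y hxy => ?_⟩
    have h : s((Quot.out s(x, y)).1, (Quot.out s(x, y)).2) = s(x, y) := Quot.out_eq s(x, y)
    rcases Sym2.eq_iff.1 h with ⟨h1, h2⟩ | ⟨h1, h2⟩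
    · show (st (Quot.out s(x, y)).1).1 (Quot.out s(x, y)).2 = _
      rw [h1, h2]
    · show (st (Quot.out s(x, y)).1).1 (Quot.out s(x, y)).2 = _
      rw [h1, h2]; exact hsymm y x hxy.symm
  have hinj : ∀ v x y, T.Adj v x → T.Adj v y → φ s(v, x) = φ s(v, y) → x = y := by
    intro v x y hx hy h
    rw [hφ v x hx, hφ v y hy] at h
    exact (hG v).1 (by simpa using hx) (by simpa using hy) h
  -- no bichromatic path whose first middle vertex is the parent
  have hdown : ∀ x0 x1 x2 x3 x4, T.Adj x0 x1 → T.Adj x1 x2 → T.Adj x2 x3 → T.Adj x3 x4 →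
      x0 ≠ x2 → x2 ≠ x4 → x2 ≠ r → par x2 = x1 → x3 ≠ r → par x3 = x2 →
      φ s(x0, x1) = φ s(x2, x3) → φ s(x1, x2) = φ s(x3, x4) → False := by
    intro x0 x1 x2 x3 x4 h01 h12 h23 h34 n02 n24 hr2 hp2 hr3 hp3 c1 c2
    rw [Sym2.eq_swap, hφ x1 x0 h01.symm, hφ x2 x3 h23] at c1
    rw [hφ x1 x2 h12, hφ x3 x4 h34] at c2
    have hx3 : x3 ≠ par x2 := by
      rintro e
      apply hpp x3 hr3
      rw [hp3, ← e]
    have h1 := ((hR x2 hr2).2 x3 h23 hx3).2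
    rw [hp2] at h1
    have h2 := h1 (Finset.mem_image.2 ⟨x0, Finset.mem_erase.2 ⟨n02, by simpa using h01.symm⟩, c1⟩)
    have h3 := ((hR x3 hr3).2 x4 h34 (by rw [hp3]; exact n24.symm)).1
    rw [hp3, ← c2] at h3
    exact h3 h2
  have hpath : ∀ x0 x1 x2 x3 x4, T.Adj x0 x1 → T.Adj x1 x2 → T.Adj x2 x3 → T.Adj x3 x4 →
      x0 ≠ x2 → x1 ≠ x3 → x2 ≠ x4 →
      φ s(x0, x1) = φ s(x2, x3) → φ s(x1, x2) = φ s(x3, x4) → False := by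
    intro x0 x1 x2 x3 x4 h01 h12 h23 h34 n02 n13 n24 c1 c2
    rcases hadj x1 x2 h12 with ⟨r1, p1⟩ | ⟨r2, p2⟩
    · rcases hadj x2 x3 h23 with ⟨r2, p2⟩ | ⟨r3, p3⟩
      · refine hdown x4 x3 x2 x1 x0 h34.symm h23.symm h12.symm h01.symm n24.symm n02.symm
          r2 p2 r1 p1 ?_ ?_
        · rw [Sym2.eq_swap, ← c2, Sym2.eq_swap]
        · rw [Sym2.eq_swap, ← c1, Sym2.eq_swap]
      · have hx1 : x1 ≠ par x2 := by rw [← p1]; exact hpp x1 r1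
        have hx3 : x3 ≠ par x2 := by rw [← p3]; exact hpp x3 r3
        have a1 := ((hR x1 r1).2 x0 h01.symm (by rw [p1]; exact n02)).1
        have a3 := ((hR x3 r3).2 x4 h34 (by rw [p3]; exact n24.symm)).1
        rw [Sym2.eq_swap, hφ x1 x0 h01.symm, hφ x2 x3 h23] at c1
        rw [Sym2.eq_swap, hφ x2 x1 h12.symm, hφ x3 x4 h34] at c2
        rw [p1, c1] at a1
        rw [p3, ← c2] at a3
        rcases (hG x2).2.2 x1 x3 h12.symm hx1 h23 hx3 n13 with h | h
        · exact a1 h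
        · exact a3 h
    · obtain ⟨r3, p3⟩ := hor x2 x3 h23 (by rw [p2]; exact n13.symm)
      exact hdown x0 x1 x2 x3 x4 h01 h12 h23 h34 n02 n24 r2 p2 r3 p3 c1 c2
  refine ⟨φ, ?_, ?_, ?_, ?_⟩
  · intro e he
    induction e using Sym2.ind with
    | _ x y =>
      have hxy : T.Adj x y := he
      rcases hadj x y hxy with ⟨h, hp⟩ | ⟨h, hp⟩
      · rw [Sym2.eq_swap, hφ y x hxy.symm]
        exact ((hG y).2.1 x hxy.symm (by rw [← hp]; exact hpp x h)).1
      · rw [hφ x y hxy]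
        exact ((hG x).2.1 y hxy (by rw [← hp]; exact hpp y h)).1
  · rintro e₁ h₁ e₂ h₂ ⟨hne, v, hv1, hv2⟩ heq
    obtain ⟨x, rfl⟩ := Sym2.mem_iff_exists.1 hv1
    obtain ⟨y, rfl⟩ := Sym2.mem_iff_exists.1 hv2
    exact hne (by rw [hinj v x y h₁ h₂ heq])
  · rintro u v p hp hlen ⟨c₁, c₂, hc⟩
    match p, hp, hlen, hc with
    | .cons (v := x1) h01 (.cons (v := x2) h12 (.cons (v := x3) h23 (.cons (v := x4) h34 .nil))),
        hp, _, hc =>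
      simp only [Walk.edges_cons, Walk.edges_nil, List.mem_cons, List.not_mem_nil, or_false,
        forall_eq_or_imp, forall_eq] at hc
      simp only [Walk.cons_isPath_iff, Walk.support_cons, Walk.support_nil, List.mem_cons,
        List.not_mem_nil, or_false, not_or] at hp
      obtain ⟨⟨⟨⟨-, -⟩, -, n24⟩, -, n13, -⟩, -, n02, -⟩ := hp
      obtain ⟨d1, d2, d3, d4⟩ := hc
      have m1 : φ s(u, x1) ≠ φ s(x1, x2) := by
        rw [Sym2.eq_swap]
        exact fun h => n02 (hinj x1 _ _ h01.symm h12 h)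
      have m2 : φ s(x1, x2) ≠ φ s(x2, x3) := by
        rw [Sym2.eq_swap]
        exact fun h => n13 (hinj x2 _ _ h12.symm h23 h)
      have m3 : φ s(x2, x3) ≠ φ s(x3, x4) := by
        rw [Sym2.eq_swap]
        exact fun h => n24 (hinj x3 _ _ h23.symm h34 h)
      exact hpath u x1 x2 x3 x4 h01 h12 h23 h34 n02 n13 n24 (by omega) (by omega)
  · intro u p hp _ _
    exact hT.isAcyclic p hp

theorem stmt_4 {V : Type*} [Fintype V] (T : SimpleGraph V) (hT : T.IsTree)
    (hE : T.edgeSet.Nonempty) :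
    listStarChromaticIndex T ≤ (oreDegree T + T.maxDegree) / 2 := by
  apply Nat.sInf_le
  obtain ⟨e, he⟩ := hE
  have hnt : Nontrivial V := by
    induction e using Sym2.ind with
    | _ x y => exact ⟨x, y, T.ne_of_adj he⟩
  refine starChoosable_tree T hT _ (fun x y hxy => ?_)
  have h1 : T.degree x + T.degree y ≤ oreDegree T := by
    apply le_csSup
    · refine ⟨T.maxDegree + T.maxDegree, ?_⟩
      rintro n ⟨a, b, -, rfl⟩
      exact Nat.add_le_add (T.degree_le_maxDegree a) (T.degree_le_maxDegree b)
    · exact ⟨x, y, hxy, rfl⟩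
  have h2 := T.degree_le_maxDegree y
  omega
end

section
/- If H = T ∪ C is a generalized Halin graph whose adjoint cycle C has length different from 5, then ch'_star(H) ≤ max{⌊(θ(T) + Δ(T))/2⌋, 2⌊Δ(T)/2⌋ + 7}. -/
open SimpleGraph
open scoped Classical

/-- From a window-good sequence on naturals with a seam of period `n`, get a cyclic one. -/
lemma cyc_of_seq (n : ℕ) (hn : 3 ≤ n) (L : ZMod n → Finset ℕ) (g : ℕ → ℕ)
    (hseam : ∀ j < 3, g (n + j) = g j)
    (hL : ∀ i : ZMod n, g i.val ∈ L i)
    (h1 : ∀ i < n, g i ≠ g (i + 1))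
    (h2 : ∀ i < n, ¬ (g i = g (i + 2) ∧ g (i + 1) = g (i + 3))) :
    ∃ f : ZMod n → ℕ, ∀ i, f i ∈ L i ∧ f i ≠ f (i + 1) ∧
      ¬ (f i = f (i + 2) ∧ f (i + 1) = f (i + 3)) := by
  have : NeZero n := ⟨by omega⟩
  have key : ∀ (i : ZMod n) (j : ℕ), j ≤ 3 → g ((i + (j : ZMod n)).val) = g (i.val + j) := by
    intro i j hj
    have hi := ZMod.val_lt i
    have e : (i + (j : ZMod n)).val = (i.val + j) % n := by
      rw [ZMod.val_add, ZMod.val_natCast, Nat.add_mod_mod]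
    rw [e]
    by_cases hlt : i.val + j < n
    · rw [Nat.mod_eq_of_lt hlt]
    · obtain ⟨t, ht⟩ : ∃ t, i.val + j = n + t := ⟨i.val + j - n, by omega⟩
      have ht3 : t < 3 := by omega
      rw [ht, hseam t ht3, Nat.add_mod_left, Nat.mod_eq_of_lt (by omega)]
  refine ⟨fun i => g i.val, fun i => ⟨hL i, ?_, ?_⟩⟩
  · have := key i 1 (by omega)
    simp only [Nat.cast_one] at this
    show g i.val ≠ g (i + 1).val
    rw [this]
    exact h1 _ (ZMod.val_lt i)
  · have k1 := key i 1 (by omega)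
    have k2 := key i 2 (by omega)
    have k3 := key i 3 (by omega)
    simp only [Nat.cast_one, Nat.cast_ofNat] at k1 k2 k3
    show ¬ (g i.val = g (i + 2).val ∧ g (i + 1).val = g (i + 3).val)
    rw [k1, k2, k3]
    exact h2 _ (ZMod.val_lt i)

lemma exists_avoid (S : Finset ℕ) (B : Finset ℕ) (h : B.card < S.card) : ∃ a ∈ S, a ∉ B := by
  by_contra hcon
  push Not at hcon
  exact absurd (Finset.card_le_card (fun a ha => hcon a ha)) (by omega)

lemma exists_avoid2 (S : Finset ℕ) (h : 3 ≤ S.card) (a b : ℕ) : ∃ x ∈ S, x ≠ a ∧ x ≠ b := by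
  obtain ⟨x, hx, hxn⟩ := exists_avoid S {a, b} (lt_of_le_of_lt Finset.card_le_two (by omega))
  simp at hxn
  exact ⟨x, hx, hxn.1, hxn.2⟩

/-- the greedy sequence -/
noncomputable def greedySeq (ch : ℕ → ℕ → ℕ → ℕ) (c : ℕ) : ℕ → ℕ × ℕ
  | 0 => (c, c)
  | (i + 1) => ((greedySeq ch c i).2, ch (i + 1) (greedySeq ch c i).1 (greedySeq ch c i).2)

/-- greedy colouring around the cycle when some colour of `L 0` is missing in `L (n-1)` -/
lemma cyc_greedy (n : ℕ) (hn : 3 ≤ n) (L : ℕ → Finset ℕ) (hL : ∀ i, 3 ≤ (L i).card)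
    (c : ℕ) (hc : c ∈ L 0) (hc' : c ∉ L (n - 1)) :
    ∃ g : ℕ → ℕ, (∀ j < 3, g (n + j) = g j) ∧ (∀ i < n, g i ∈ L i) ∧
      (∀ i < n, g i ≠ g (i + 1)) ∧
      (∀ i < n, ¬ (g i = g (i + 2) ∧ g (i + 1) = g (i + 3))) := by
  have hch : ∀ i a b, ∃ x, x ∈ L i ∧ x ≠ a ∧ x ≠ b := by
    intro i a b
    obtain ⟨x, h1, h2, h3⟩ := exists_avoid2 (L i) (hL i) a b
    exact ⟨x, h1, h2, h3⟩
  choose ch hch1 hch2 hch3 using hch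
  let h : ℕ → ℕ := fun i => (greedySeq ch c i).2
  have h0 : h 0 = c := rfl
  have hs1 : h 1 = ch 1 c c := rfl
  have hs : ∀ i, h (i + 2) = ch (i + 2) (h i) (h (i + 1)) := fun i => rfl
  have hm : ∀ i, h i ∈ L i := by
    intro i
    match i with
    | 0 => exact hc
    | 1 => rw [hs1]; exact hch1 _ _ _
    | (i + 2) => rw [hs]; exact hch1 _ _ _
  have hd1 : ∀ i, h (i + 1) ≠ h i := by
    intro i
    match i with
    | 0 => rw [hs1, h0]; exact hch2 _ _ _
    | (i + 1) => rw [hs]; exact hch3 _ _ _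
  have hd2 : ∀ i, h (i + 2) ≠ h i := by
    intro i; rw [hs]; exact hch2 _ _ _
  -- the values at positions n-2, n-1
  obtain ⟨m, rfl⟩ : ∃ m, n = m + 3 := ⟨n - 3, by omega⟩
  let a := ch (m + 1) c (h m)
  let b := ch (m + 2) (h m) a
  have ha1 : a ∈ L (m + 1) := hch1 _ _ _
  have ha2 : a ≠ c := hch2 _ _ _
  have ha3 : a ≠ h m := hch3 _ _ _
  have hb1 : b ∈ L (m + 2) := hch1 _ _ _
  have hb2 : b ≠ h m := hch2 _ _ _
  have hb3 : b ≠ a := hch3 _ _ _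
  have hbc : b ≠ c := by
    rintro hbc
    apply hc'
    rw [← hbc]
    exact hb1
  clear_value a b
  let w : ℕ → ℕ := fun i => if i ≤ m then h i else if i = m + 1 then a else b
  have w0 : w 0 = c := by simp [w, h0]
  have wle : ∀ i ≤ m, w i = h i := fun i hi => by simp [w, hi]
  have wa : w (m + 1) = a := by simp [w]
  have wb : w (m + 2) = b := by simp [w]
  have ww1 : ∀ i, i + 1 < m + 3 → w i ≠ w (i + 1) := by
    intro i hi
    rcases (by omega : i + 1 ≤ m ∨ i = m ∨ i = m + 1) with h' | rfl | rfl
    · rw [wle i (by omega), wle _ h']; exact (hd1 i).symm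
    · rw [wle i le_rfl, wa]; exact ha3.symm
    · rw [wa, wb]; exact hb3.symm
  have w12 : w (m + 2) ≠ w 0 := by rw [wb, w0]; exact hbc
  have w11 : w (m + 1) ≠ w 0 := by rw [wa, w0]; exact ha2
  -- distance two: all but `m-1, m+1` and wrap `m+2, 1`
  have ww2 : ∀ i, i + 2 ≤ m → w i ≠ w (i + 2) := by
    intro i hi
    rw [wle i (by omega), wle _ hi]; exact (hd2 i).symm
  have ww2' : w m ≠ w (m + 2) := by rw [wle m le_rfl, wb]; exact hb2.symm
  have ww02 : w 0 ≠ w 2 := by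
    rcases (by omega : 2 ≤ m ∨ m = 1 ∨ m = 0) with h' | rfl | rfl
    · exact ww2 0 (by omega)
    · exact w11.symm
    · exact w12.symm
  clear_value w
  have hwm : ∀ i < m + 3, w i ∈ L i := by
    intro i hi
    rcases (by omega : i ≤ m ∨ i = m + 1 ∨ i = m + 2) with h' | rfl | rfl
    · rw [wle i h']; exact hm i
    · rw [wa]; exact ha1
    · rw [wb]; exact hb1
  refine ⟨fun i => w (i % (m + 3)), ?_, ?_, ?_, ?_⟩
  · intro j hj; simp
  · intro i hi
    simp only [Nat.mod_eq_of_lt hi]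
    exact hwm i hi
  · intro i hi
    simp only [Nat.mod_eq_of_lt hi]
    rcases (by omega : i + 1 < m + 3 ∨ i = m + 2) with h' | rfl
    · rw [Nat.mod_eq_of_lt h']; exact ww1 i h'
    · simpa using w12
  · intro i hi
    simp only [Nat.mod_eq_of_lt hi]
    rcases (by omega : i + 2 ≤ m ∨ i = m ∨ i + 1 = m ∨ i = m + 1 ∨ i = m + 2) with
      h' | rfl | rfl | rfl | rfl
    · rw [Nat.mod_eq_of_lt (by omega : i + 2 < m + 3)]
      exact fun hh => ww2 i h' hh.1
    · rw [Nat.mod_eq_of_lt (by omega : i + 2 < i + 3)]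
      exact fun hh => ww2' hh.1
    · rw [Nat.mod_eq_of_lt (by omega : i + 1 < i + 1 + 3),
        Nat.mod_eq_of_lt (by omega : i + 3 < i + 1 + 3)]
      exact fun hh => ww2' hh.2
    · rw [show (m + 1 + 2) % (m + 3) = 0 from Nat.mod_self _]
      exact fun hh => w11 hh.1
    · rw [show (m + 2 + 1) % (m + 3) = 0 from Nat.mod_self _,
        show (m + 2 + 3) % (m + 3) = 2 by
          rw [show m + 2 + 3 = 2 + (m + 3) by ring, Nat.add_mod_right, Nat.mod_eq_of_lt (by omega)]]
      exact fun hh => ww02 hh.2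

/-- pattern with three colours -/
lemma cyc_pattern (n : ℕ) (hn : 3 ≤ n) (h5 : n ≠ 5) :
    ∃ g : ℕ → ℕ, (∀ j < 3, g (n + j) = g j) ∧ (∀ i, g i < 3) ∧
      (∀ i < n, g i ≠ g (i + 1)) ∧
      (∀ i < n, ¬ (g i = g (i + 2) ∧ g (i + 1) = g (i + 3))) := by
  rcases (by omega : n % 3 = 0 ∨ (n % 3 = 1) ∨ (n % 3 = 2)) with h | h | h
  · refine ⟨fun i => i % 3, ?_, ?_, ?_, ?_⟩
    · intro j hj; show (n + j) % 3 = j % 3; omega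
    · intro i; exact Nat.mod_lt _ (by omega)
    · intro i hi; show i % 3 ≠ (i + 1) % 3; omega
    · intro i hi; show ¬ (i % 3 = (i + 2) % 3 ∧ (i + 1) % 3 = (i + 3) % 3); omega
  · by_cases h4 : n = 4
    · subst h4
      refine ⟨fun i => if i % 4 = 3 then 2 else if i % 4 = 1 then 1 else 0, ?_, ?_, ?_, ?_⟩
      · intro j hj; interval_cases j <;> rfl
      · intro i; dsimp only; split_ifs <;> omega
      · intro i hi; interval_cases i <;> decide
      · intro i hi; interval_cases i <;> decide
    · obtain ⟨w, hw⟩ : ∃ w : ℕ → ℕ, ∀ i, (i < n - 2 ∧ w i = i % 3) ∨ (i = n - 2 ∧ w i = 0) ∨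
          (n - 2 < i ∧ w i = (i + 2) % 3) := by
        refine ⟨fun i => if i < n - 2 then i % 3 else if i = n - 2 then 0 else (i + 2) % 3, ?_⟩
        intro i
        dsimp only
        split_ifs <;> omega
      refine ⟨w, ?_, ?_, ?_, ?_⟩
      · intro j hj; have := hw j; have := hw (n + j); omega
      · intro i; have := hw i; omega
      · intro i hi; have := hw i; have := hw (i + 1); omega
      · intro i hi
        have := hw i; have := hw (i + 1); have := hw (i + 2); have := hw (i + 3); omega
  · by_cases h8 : n = 8
    · subst h8
      refine ⟨fun i => if i % 4 = 3 then 2 else if i % 4 = 1 then 1 else 0, ?_, ?_, ?_, ?_⟩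
      · intro j hj; interval_cases j <;> rfl
      · intro i; dsimp only; split_ifs <;> omega
      · intro i hi; interval_cases i <;> decide
      · intro i hi; interval_cases i <;> decide
    · obtain ⟨w, hw⟩ : ∃ w : ℕ → ℕ, ∀ i, (i < n - 6 ∧ w i = i % 3) ∨ (i = n - 6 ∧ w i = 0) ∨
          (n - 6 < i ∧ i < n - 2 ∧ w i = (i + 2) % 3) ∨ (i = n - 2 ∧ w i = 0) ∨
          (n - 2 < i ∧ w i = (i + 1) % 3) := by
        refine ⟨fun i => if i < n - 6 then i % 3 else if i = n - 6 then 0 else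
          if i < n - 2 then (i + 2) % 3 else if i = n - 2 then 0 else (i + 1) % 3, ?_⟩
        intro i
        dsimp only
        split_ifs <;> omega
      refine ⟨w, ?_, ?_, ?_, ?_⟩
      · intro j hj; have := hw j; have := hw (n + j); omega
      · intro i; have := hw i; omega
      · intro i hi; have := hw i; have := hw (i + 1); omega
      · intro i hi
        have := hw i; have := hw (i + 1); have := hw (i + 2); have := hw (i + 3); omega

lemma cycle_list (n : ℕ) (hn : 3 ≤ n) (h5 : n ≠ 5) (L : ZMod n → Finset ℕ)
    (hL : ∀ i, 3 ≤ (L i).card) :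
    ∃ f : ZMod n → ℕ, ∀ i, f i ∈ L i ∧ f i ≠ f (i + 1) ∧
      ¬ (f i = f (i + 2) ∧ f (i + 1) = f (i + 3)) := by
  have : NeZero n := ⟨by omega⟩
  have : ∀ i, ∃ S, S ⊆ L i ∧ S.card = 3 := fun i => Finset.exists_subset_card_eq (hL i)
  choose S hS hS3 using this
  suffices hh : ∃ f : ZMod n → ℕ, ∀ i, f i ∈ S i ∧ f i ≠ f (i + 1) ∧
      ¬ (f i = f (i + 2) ∧ f (i + 1) = f (i + 3)) by
    obtain ⟨f, hf⟩ := hh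
    exact ⟨f, fun i => ⟨hS i (hf i).1, (hf i).2⟩⟩
  by_cases hall : ∀ i, S (i + 1) = S i
  · have hS0 : ∀ j : ℕ, S (j : ZMod n) = S 0 := by
      intro j
      induction j with
      | zero => simp
      | succ j ih => rw [Nat.cast_succ, hall, ih]
    have hS0' : ∀ i, S i = S 0 := fun i => by
      have := hS0 i.val
      rwa [ZMod.natCast_zmod_val] at this
    obtain ⟨x, y, z, hxy, hxz, hyz, hxyz⟩ := Finset.card_eq_three.mp (hS3 0)
    obtain ⟨g, g1, g2, g3, g4⟩ := cyc_pattern n hn h5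
    let col : ℕ → ℕ := fun i => if i = 0 then x else if i = 1 then y else z
    have hcol : ∀ i < 3, ∀ j < 3, col i = col j → i = j := by
      intro i hi j hj
      simp only [col]
      interval_cases i <;> interval_cases j <;> simp_all <;> (intro h; simp_all)
    have hcolm : ∀ i, col i ∈ S 0 := by
      intro i
      rw [hxyz]
      simp only [col]
      split_ifs <;> simp
    apply cyc_of_seq n hn S (fun i => col (g i))
    · intro j hj; simp only [g1 j hj]
    · intro i; rw [hS0' i]; exact hcolm _
    · intro i hi h; exact g3 i hi (hcol _ (g2 _) _ (g2 _) h)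
    · intro i hi h
      exact g4 i hi ⟨hcol _ (g2 _) _ (g2 _) h.1, hcol _ (g2 _) _ (g2 _) h.2⟩
  · push Not at hall
    obtain ⟨t, ht⟩ := hall
    have hnot : ¬ S (t + 1) ⊆ S t := by
      intro hsub
      exact ht (Finset.eq_of_subset_of_card_le hsub (by rw [hS3, hS3]))
    obtain ⟨c, hc, hc'⟩ := Finset.not_subset.mp hnot
    -- rotate so that `t+1` is the origin
    let L' : ℕ → Finset ℕ := fun i => S ((i : ZMod n) + (t + 1))
    have e1 : ((n - 1 : ℕ) : ZMod n) + (t + 1) = t := by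
      rw [Nat.cast_sub (by omega)]; simp
    obtain ⟨g, g1, g2, g3, g4⟩ := cyc_greedy n hn L' (fun i => (hS3 _).ge) c
      (by simpa [L'] using hc) (by simp only [L']; rw [e1]; exact hc')
    obtain ⟨f, hf⟩ := cyc_of_seq n hn (fun i => S (i + (t + 1))) g g1
      (fun i => by
        have := g2 i.val (ZMod.val_lt i)
        simp only [L', ZMod.natCast_zmod_val] at this
        exact this) g3 g4
    refine ⟨fun i => f (i - (t + 1)), fun i => ?_⟩
    have := hf (i - (t + 1))
    simp only [sub_add_cancel] at this
    dsimp only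
    rw [show i + 1 - (t + 1) = i - (t + 1) + 1 by ring, show i + 2 - (t + 1) = i - (t + 1) + 2 by ring,
      show i + 3 - (t + 1) = i - (t + 1) + 3 by ring]
    exact this

/-- balanced tournaments in which the vertices of a given set `B` have small out-degree -/
lemma tour {α : Type*} (s : ℕ) : ∀ (S B : Finset α), S.card = s → B ⊆ S →
    B.card ≤ (s + 1) / 2 →
    ∃ R : α → Finset α, (∀ i ∈ S, R i ⊆ S.erase i) ∧
      (∀ i ∈ S, ∀ j ∈ S, i ≠ j → j ∈ R i ∨ i ∈ R j) ∧
      (∀ i ∈ S, (R i).card ≤ s / 2) ∧ (∀ i ∈ B, (R i).card + 1 ≤ (s + 1) / 2) := by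
  induction s using Nat.strong_induction_on with
  | _ s ih =>
  intro S B hS hBS hB
  rcases (by omega : s = 0 ∨ s = 1 ∨ 2 ≤ s) with h0 | h1 | h2
  · subst h0
    rw [Finset.card_eq_zero] at hS
    subst hS
    refine ⟨fun _ => ∅, by simp, by simp, by simp, ?_⟩
    intro i hi
    exact absurd (hBS hi) (by simp)
  · subst h1
    obtain ⟨a, rfl⟩ := Finset.card_eq_one.mp hS
    refine ⟨fun _ => ∅, by simp, by simp, by simp, by simp⟩
  · obtain ⟨x, hxS, hxB⟩ : ∃ x ∈ S, x ∉ B := by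
      by_contra hcon
      push Not at hcon
      have := Finset.card_le_card (fun a ha => hcon a ha : S ⊆ B)
      omega
    obtain ⟨y, hyS, hyx, hyB⟩ : ∃ y ∈ S, y ≠ x ∧ (y ∈ B ∨ B = ∅) := by
      rcases B.eq_empty_or_nonempty with he | ⟨y, hy⟩
      · obtain ⟨y, hy⟩ : (S.erase x).Nonempty := by
          rw [← Finset.card_pos, Finset.card_erase_of_mem hxS]; omega
        rw [Finset.mem_erase] at hy
        exact ⟨y, hy.2, hy.1, Or.inr he⟩
      · exact ⟨y, hBS hy, fun h => hxB (h ▸ hy), Or.inl hy⟩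
    set S' := (S.erase x).erase y with hS'
    have hyS1 : y ∈ S.erase x := Finset.mem_erase.mpr ⟨hyx, hyS⟩
    have cS' : S'.card = s - 2 := by
      rw [hS', Finset.card_erase_of_mem hyS1, Finset.card_erase_of_mem hxS]; omega
    have hB' : B.erase y ⊆ S' := by
      intro a ha
      rw [Finset.mem_erase] at ha
      simp only [hS', Finset.mem_erase]
      exact ⟨ha.1, fun h => hxB (h ▸ ha.2), hBS ha.2⟩
    have cB' : (B.erase y).card ≤ (s - 2 + 1) / 2 := by
      rcases hyB with h | h
      · rw [Finset.card_erase_of_mem h]; omega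
      · subst h; simp
    obtain ⟨R, r1, r2, r3, r4⟩ := ih (s - 2) (by omega) S' (B.erase y) cS' hB' cB'
    obtain ⟨U, hU, cU⟩ := Finset.exists_subset_card_eq (s := S') (n := (s - 2) / 2) (by omega)
    have mS : ∀ a, a ∈ S ↔ a = x ∨ a = y ∨ a ∈ S' := by
      intro a
      simp only [hS', Finset.mem_erase]
      constructor
      · intro h; tauto
      · rintro (rfl | rfl | h)
        · exact hxS
        · exact hyS
        · exact h.2.2
    have hxS' : x ∉ S' := by simp [hS']
    have hyS' : y ∉ S' := by simp [hS']
    refine ⟨fun i => if i = x then insert y U else if i = y then S' \ U else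
      insert (if i ∈ U then y else x) (R i), ?_, ?_, ?_, ?_⟩
    · intro i hi a ha
      dsimp only at ha
      rw [Finset.mem_erase, mS]
      split_ifs at ha with h1 h2 h3
      · subst h1
        rw [Finset.mem_insert] at ha
        rcases ha with rfl | ha
        · exact ⟨hyx, by tauto⟩
        · exact ⟨fun h => hxS' (h ▸ hU ha), Or.inr (Or.inr (hU ha))⟩
      · subst h2
        rw [Finset.mem_sdiff] at ha
        exact ⟨fun h => hyS' (h ▸ ha.1), Or.inr (Or.inr ha.1)⟩
      all_goals
        have hiS' : i ∈ S' := by have := (mS i).mp hi; tauto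
        rw [Finset.mem_insert] at ha
        rcases ha with rfl | ha
        · exact ⟨fun h => by tauto, by tauto⟩
        · have := r1 i hiS' ha
          rw [Finset.mem_erase] at this
          tauto
    · have key : ∀ i ∈ S, ∀ j ∈ S, i ≠ j → (i = x ∨ (j ≠ x ∧ i = y) ∨ (i ∈ S' ∧ j ∈ S')) →
        (j ∈ (if i = x then insert y U else if i = y then S' \ U else
          insert (if i ∈ U then y else x) (R i)) ∨ i ∈ (if j = x then insert y U else
          if j = y then S' \ U else insert (if j ∈ U then y else x) (R j))) := by
        intro i hi j hj hij h
        rcases h with rfl | ⟨hjx, rfl⟩ | ⟨hi', hj'⟩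
        · rw [if_pos rfl, if_neg hij.symm]
          rw [mS] at hj
          rcases hj with rfl | rfl | hj
          · exact absurd rfl hij
          · left; simp
          · have : j ≠ y := fun h => hyS' (h ▸ hj)
            rw [if_neg this]
            by_cases hjU : j ∈ U
            · left; simp [hjU]
            · right; simp [hjU]
        · rw [if_neg hyx, if_pos rfl, if_neg hjx, if_neg hij.symm]
          have hjS' : j ∈ S' := by have := (mS j).mp hj; tauto
          by_cases hjU : j ∈ U
          · right; simp [hjU]
          · left; simp [hjU, hjS']
        · have a1 : i ≠ x := fun h => hxS' (h ▸ hi')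
          have a2 : i ≠ y := fun h => hyS' (h ▸ hi')
          have a3 : j ≠ x := fun h => hxS' (h ▸ hj')
          have a4 : j ≠ y := fun h => hyS' (h ▸ hj')
          rw [if_neg a1, if_neg a2, if_neg a3, if_neg a4]
          rcases r2 i hi' j hj' hij with h | h
          · left; exact Finset.mem_insert_of_mem h
          · right; exact Finset.mem_insert_of_mem h
      intro i hi j hj hij
      dsimp only
      have hi' := (mS i).mp hi
      have hj' := (mS j).mp hj
      by_cases hc : i = x ∨ (j ≠ x ∧ i = y) ∨ (i ∈ S' ∧ j ∈ S')
      · exact key i hi j hj hij hc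
      · exact (key j hj i hi hij.symm (by tauto)).symm
    · intro i hi
      dsimp only
      have hi' := (mS i).mp hi
      split_ifs with h1 h2 h3
      · have := Finset.card_insert_le y U; omega
      · rw [Finset.card_sdiff_of_subset hU]; omega
      · have := Finset.card_insert_le y (R i)
        have := r3 i (by tauto)
        omega
      · have := Finset.card_insert_le x (R i)
        have := r3 i (by tauto)
        omega
    · intro i hi
      dsimp only
      have hi' := (mS i).mp (hBS hi)
      split_ifs with h1 h2 h3
      · exact absurd (h1 ▸ hi) hxB
      · rw [Finset.card_sdiff_of_subset hU]; omega
      · have := Finset.card_insert_le y (R i)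
        have := r4 i (by simp; tauto)
        omega
      · have := Finset.card_insert_le x (R i)
        have := r4 i (by simp; tauto)
        omega

lemma half_sel {γ : Type*} (p : ℕ → γ) (S : Finset ℕ) (β : ℕ → ℕ) (a : ℕ)
    (hβ : ∀ b, (S.filter (fun i => β i = b)).card ≤ 2) :
    ∃ S' ⊆ S, a ∉ S' ∧ (∀ i ∈ S', ∀ j ∈ S', β i = β j → i = j) ∧
      ∀ g, (S.filter (fun i => p i = g)).card / 2 ≤ (S'.filter (fun i => p i = g)).card := by
  let q : γ → Finset ℕ := fun g => S.filter (fun i => p i = g)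
  let t : (Σ g : γ, Fin ((q g).card / 2)) → Finset ℕ := fun x => ((q x.1).erase a).image β
  have hall : ∀ A : Finset (Σ g : γ, Fin ((q g).card / 2)), A.card ≤ (A.biUnion t).card := by
    intro A
    let G := A.image Sigma.fst
    have h1 : A.card ≤ ∑ g ∈ G, (q g).card / 2 := by
      have : A ⊆ G.sigma (fun _ => Finset.univ) := by
        intro x hx
        rw [Finset.mem_sigma]
        exact ⟨Finset.mem_image_of_mem _ hx, Finset.mem_univ _⟩
      have := Finset.card_le_card this
      rw [Finset.card_sigma] at this
      simpa using this
    let SG := G.biUnion q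
    have h2 : SG.card = ∑ g ∈ G, (q g).card := by
      apply Finset.card_biUnion
      intro g _ g' _ hne
      rw [Function.onFun, Finset.disjoint_left]
      intro i hi hi'
      simp only [q, Finset.mem_filter] at hi hi'
      exact hne (hi.2.symm.trans hi'.2)
    have h3 : (SG.erase a).image β ⊆ A.biUnion t := by
      intro b hb
      rw [Finset.mem_image] at hb
      obtain ⟨i, hi, rfl⟩ := hb
      rw [Finset.mem_erase, Finset.mem_biUnion] at hi
      obtain ⟨hia, g, hg, hig⟩ := hi
      obtain ⟨x, hx, rfl⟩ := Finset.mem_image.mp hg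
      rw [Finset.mem_biUnion]
      exact ⟨x, hx, Finset.mem_image_of_mem _ (Finset.mem_erase.mpr ⟨hia, hig⟩)⟩
    have h4 : (SG.erase a).card ≤ 2 * ((SG.erase a).image β).card := by
      apply Finset.card_le_mul_card_image
      intro b _
      refine (Finset.card_le_card ?_).trans (hβ b)
      intro i hi
      rw [Finset.mem_filter, Finset.mem_erase, Finset.mem_biUnion] at hi
      obtain ⟨⟨_, g, _, hig⟩, hb⟩ := hi
      rw [Finset.mem_filter]
      exact ⟨(Finset.mem_filter.mp hig).1, hb⟩
    have h5 := Finset.card_le_card h3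
    have h6 : SG.card - 1 ≤ (SG.erase a).card := Finset.pred_card_le_card_erase
    have h7 : 2 * ∑ g ∈ G, (q g).card / 2 ≤ ∑ g ∈ G, (q g).card := by
      rw [Finset.mul_sum]
      exact Finset.sum_le_sum (fun g _ => Nat.mul_div_le _ _)
    omega
  obtain ⟨f, finj, hf⟩ := (Finset.all_card_le_biUnion_card_iff_exists_injective t).mp hall
  have : ∀ x, ∃ i ∈ (q x.1).erase a, β i = f x := fun x => Finset.mem_image.mp (hf x)
  choose e he1 he2 using this
  let S' := ((S.image p).sigma (fun g => (Finset.univ : Finset (Fin ((q g).card / 2))))).image e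
  refine ⟨S', ?_, ?_, ?_, ?_⟩
  · intro i hi
    obtain ⟨x, _, rfl⟩ := Finset.mem_image.mp hi
    exact (Finset.mem_filter.mp (Finset.mem_of_mem_erase (he1 x))).1
  · intro ha
    obtain ⟨x, _, hx⟩ := Finset.mem_image.mp ha
    exact (Finset.mem_erase.mp (he1 x)).1 hx
  · intro i hi j hj hij
    obtain ⟨x, _, rfl⟩ := Finset.mem_image.mp hi
    obtain ⟨y, _, rfl⟩ := Finset.mem_image.mp hj
    rw [he2, he2] at hij
    rw [finj hij]
  · intro g
    by_cases hg : g ∈ S.image p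
    · have : ((Finset.univ : Finset (Fin ((q g).card / 2))).image (fun j => e ⟨g, j⟩)) ⊆
          S'.filter (fun i => p i = g) := by
        intro i hi
        obtain ⟨j, _, rfl⟩ := Finset.mem_image.mp hi
        rw [Finset.mem_filter]
        refine ⟨Finset.mem_image_of_mem _ ?_, ?_⟩
        · rw [Finset.mem_sigma]; exact ⟨hg, Finset.mem_univ _⟩
        · exact (Finset.mem_filter.mp (Finset.mem_of_mem_erase (he1 ⟨g, j⟩))).2
      have h2 := Finset.card_le_card this
      rw [Finset.card_image_of_injective] at h2
      · simpa [q] using h2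
      · intro j j' hjj
        dsimp only at hjj
        have : f ⟨g, j⟩ = f ⟨g, j'⟩ := by rw [← he2, ← he2, hjj]
        have := finj this
        simpa using this
    · have : S.filter (fun i => p i = g) = ∅ := by
        rw [Finset.filter_eq_empty_iff]
        intro i hi h
        exact hg (h ▸ Finset.mem_image_of_mem p hi)
      rw [this]; simp

lemma indep_sel {γ : Type*} (p : ℕ → γ) (n : ℕ) :
    ∃ X ⊆ Finset.range n, 0 ∉ X ∧ (∀ i ∈ X, i + 1 ∉ X) ∧
      ∀ g, ((Finset.range n).filter (fun i => p i = g)).card / 2 / 2 ≤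
        (X.filter (fun i => p i = g)).card := by
  obtain ⟨S1, s1, s2, s3, s4⟩ := half_sel p (Finset.range n) (fun i => i / 2) 0 (by
    intro b
    refine (Finset.card_le_card (?_ : _ ⊆ ({2 * b, 2 * b + 1} : Finset ℕ))).trans Finset.card_le_two
    intro i hi
    have := (Finset.mem_filter.mp hi).2
    simp only [Finset.mem_insert, Finset.mem_singleton]
    omega)
  obtain ⟨S2, t1, t2, t3, t4⟩ := half_sel p S1 (fun i => (i + 1) / 2) 0 (by
    intro b
    refine (Finset.card_le_card (?_ : _ ⊆ ({2 * b, 2 * b - 1} : Finset ℕ))).trans Finset.card_le_two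
    intro i hi
    have := (Finset.mem_filter.mp hi).2
    simp only [Finset.mem_insert, Finset.mem_singleton]
    omega)
  refine ⟨S2, t1.trans s1, t2, ?_, ?_⟩
  · intro i hi hi1
    rcases (by omega : i / 2 = (i + 1) / 2 ∨ (i + 1) / 2 = (i + 1 + 1) / 2) with h | h
    · have := s3 i (t1 hi) _ (t1 hi1) h; omega
    · have := t3 i hi _ hi1 h; omega
  · intro g
    exact (Nat.div_le_div_right (s4 g)).trans (t4 g)

/-- the group invariant -/
def GInv {V : Type*} (nb : V → Finset V) (k : ℕ) (Kg : Finset V) (Z : Finset V)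
    (M : V → Finset ℕ) : Prop :=
  (∀ x ∈ Kg, ∀ y ∈ Kg, x ≠ y → k ≤ (M x ∪ M y).card + 1 ∧
    ∀ z ∈ nb x, z ∈ nb y → z ∉ Z → k ≤ (M x ∪ M y).card) ∧
  (Kg.card = 3 → k ≤ (Kg.biUnion M).card)

lemma erase_union_eq (A B : Finset ℕ) (a : ℕ) (h : a ∉ A \ B) : A.erase a ∪ B = A ∪ B := by
  ext b
  simp only [Finset.mem_union, Finset.mem_erase, Finset.mem_sdiff] at *
  by_cases hb : b = a
  · subst hb; tauto
  · tauto

lemma card_erase_union (A B : Finset ℕ) (a : ℕ) : (A ∪ B).card ≤ (A.erase a ∪ B).card + 1 := by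
  have : (A ∪ B).erase a ⊆ A.erase a ∪ B := by
    intro b
    simp only [Finset.mem_union, Finset.mem_erase]
    tauto
  have h1 := Finset.card_le_card this
  have h2 := Finset.pred_card_le_card_erase (s := A ∪ B) (a := a)
  omega

lemma ginv_step {V : Type*} (nb : V → Finset V) (k : ℕ) (Kg Z : Finset V) (M : V → Finset ℕ)
    (hsym : ∀ x y, y ∈ nb x → x ∈ nb y) (hnb2 : ∀ x, (nb x).card ≤ 2)
    (hK3 : Kg.card ≤ 3)
    (m2 : ∀ x ∈ Kg, k ≤ (M x).card + 2)
    (m1 : ∀ x ∈ Kg, ∀ z ∈ nb x, z ∉ Z → k ≤ (M x).card + 1)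
    (m0 : ∀ x ∈ Kg, ∀ z ∈ nb x, ∀ z' ∈ nb x, z ∉ Z → z' ∉ Z → z ≠ z' → k ≤ (M x).card)
    (hcom : ∀ x ∈ Kg, ∀ y ∈ Kg, x ≠ y → ∀ z z', z ∈ nb x → z ∈ nb y → z' ∈ nb x → z' ∈ nb y →
      z = z')
    (hinv : GInv nb k Kg Z M) (z : V) (hz : z ∉ Z) :
    ∃ E : Finset ℕ, E.card ≤ (nb z ∩ Kg).card ∧ ∀ a ∉ E,
      GInv nb k Kg (insert z Z) (fun x => if z ∈ nb x then (M x).erase a else M x) := by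
  obtain ⟨i1, i2⟩ := hinv
  -- the critical pairs
  let crit : V → V → Prop := fun x y => (M x ∪ M y).card + 1 ≤ k ∨
    ∃ z' ∈ nb x, z' ∈ nb y ∧ z' ∉ Z ∧ z' ≠ z ∧ (M x ∪ M y).card ≤ k
  have hcrit : ∀ x ∈ Kg, ∀ w ∈ Kg, x ≠ w → z ∈ nb x → z ∉ nb w → crit x w →
      M w ⊆ M x ∧ (M x \ M w).card ≤ 1 := by
    intro x hx w hw hxw hzx hzw hc
    have e1 : (M x).card + (M w \ M x).card = (M x ∪ M w).card := by
      rw [← Finset.union_sdiff_self_eq_union, Finset.card_union_of_disjoint Finset.disjoint_sdiff]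
    have e2 : (M w).card + (M x \ M w).card = (M x ∪ M w).card := by
      rw [Finset.union_comm, ← Finset.union_sdiff_self_eq_union,
        Finset.card_union_of_disjoint Finset.disjoint_sdiff]
    have p1 := m1 x hx z hzx hz
    have p2 := m2 w hw
    rcases hc with hc | ⟨z', h1, h2, h3, h4, h5⟩
    · have : (M w \ M x).card = 0 := by omega
      rw [Finset.card_eq_zero, Finset.sdiff_eq_empty_iff_subset] at this
      exact ⟨this, by omega⟩
    · have p3 := m0 x hx z' h1 z hzx h3 hz h4
      have p4 := m1 w hw z' h2 h3
      have : (M w \ M x).card = 0 := by omega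
      rw [Finset.card_eq_zero, Finset.sdiff_eq_empty_iff_subset] at this
      exact ⟨this, by omega⟩
  let R := (Kg.filter (fun w => z ∉ nb w)).biUnion M
  let M' : ℕ → V → Finset ℕ := fun a x => if z ∈ nb x then (M x).erase a else M x
  -- after the step
  have main : ∀ a, (∀ x ∈ Kg, ∀ w ∈ Kg, x ≠ w → z ∈ nb x → z ∉ nb w → crit x w →
      a ∉ M x \ M w) → (Kg.card = 3 → (Kg.biUnion M).card ≤ k → a ∉ Kg.biUnion M \ R) →
      GInv nb k Kg (insert z Z) (M' a) := by
    intro a ha1 ha2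
    have pairs : ∀ x ∈ Kg, ∀ y ∈ Kg, x ≠ y → z ∈ nb x → k ≤ (M' a x ∪ M' a y).card + 1 ∧
        ∀ z' ∈ nb x, z' ∈ nb y → z' ∉ insert z Z → k ≤ (M' a x ∪ M' a y).card := by
      intro x hx y hy hxy hzx
      by_cases hzy : z ∈ nb y
      · simp only [M', if_pos hzx, if_pos hzy]
        have q := (i1 x hx y hy hxy).2 z hzx hzy hz
        rw [← Finset.erase_union_distrib]
        have := Finset.pred_card_le_card_erase (s := M x ∪ M y) (a := a)
        refine ⟨by omega, ?_⟩
        intro z' h1 h2 h3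
        exact absurd (hcom x hx y hy hxy z z' hzx hzy h1 h2) (fun h => h3 (by simp [h]))
      · simp only [M', if_pos hzx, if_neg hzy]
        by_cases hc : crit x y
        · rw [erase_union_eq _ _ _ (ha1 x hx y hy hxy hzx hzy hc)]
          refine ⟨(i1 x hx y hy hxy).1, ?_⟩
          intro z' h1 h2 h3
          exact (i1 x hx y hy hxy).2 z' h1 h2 (fun h => h3 (by simp [h]))
        · have q := card_erase_union (M x) (M y) a
          simp only [crit, not_or, not_exists, not_and] at hc
          refine ⟨by omega, ?_⟩
          intro z' h1 h2 h3
          simp only [Finset.mem_insert, not_or] at h3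
          have := hc.2 z' h1 h2 h3.2 h3.1
          omega
    refine ⟨?_, ?_⟩
    · intro x hx y hy hxy
      by_cases hzx : z ∈ nb x
      · exact pairs x hx y hy hxy hzx
      by_cases hzy : z ∈ nb y
      · have := pairs y hy x hx hxy.symm hzy
        rw [Finset.union_comm]
        exact ⟨this.1, fun z' h1 h2 h3 => this.2 z' h2 h1 h3⟩
      · simp only [M', if_neg hzx, if_neg hzy]
        refine ⟨(i1 x hx y hy hxy).1, ?_⟩
        intro z' h1 h2 h3
        exact (i1 x hx y hy hxy).2 z' h1 h2 (fun h => h3 (by simp [h]))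
    · intro h3
      have n3 := i2 h3
      have sub1 : (Kg.biUnion M).erase a ⊆ Kg.biUnion (M' a) := by
        intro b hb
        rw [Finset.mem_erase, Finset.mem_biUnion] at hb
        obtain ⟨hba, x, hx, hbx⟩ := hb
        rw [Finset.mem_biUnion]
        refine ⟨x, hx, ?_⟩
        simp only [M']
        split_ifs
        · exact Finset.mem_erase.mpr ⟨hba, hbx⟩
        · exact hbx
      by_cases hk : (Kg.biUnion M).card ≤ k
      · have hna := ha2 h3 hk
        have : Kg.biUnion M ⊆ Kg.biUnion (M' a) := by
          intro b hb
          by_cases hba : b = a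
          · subst hba
            have hR : b ∈ R := by
              by_contra hR
              exact hna (Finset.mem_sdiff.mpr ⟨hb, hR⟩)
            rw [Finset.mem_biUnion] at hR
            obtain ⟨w, hw, hbw⟩ := hR
            rw [Finset.mem_filter] at hw
            rw [Finset.mem_biUnion]
            refine ⟨w, hw.1, ?_⟩
            simp only [M', if_neg hw.2]
            exact hbw
          · exact sub1 (Finset.mem_erase.mpr ⟨hba, hb⟩)
        exact n3.trans (Finset.card_le_card this)
      · have := Finset.card_le_card sub1
        have := Finset.pred_card_le_card_erase (s := Kg.biUnion M) (a := a)
        omega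
  -- membership helper
  have memA : ∀ x, x ∈ nb z ∩ Kg ↔ z ∈ nb x ∧ x ∈ Kg := by
    intro x
    rw [Finset.mem_inter]
    exact ⟨fun h => ⟨hsym _ _ h.1, h.2⟩, fun h => ⟨hsym _ _ h.1, h.2⟩⟩
  have cA : (nb z ∩ Kg).card ≤ 2 := (Finset.card_le_card Finset.inter_subset_left).trans (hnb2 z)
  rcases (by omega : (nb z ∩ Kg).card = 0 ∨ (nb z ∩ Kg).card = 1 ∨ (nb z ∩ Kg).card = 2)
    with h0 | h1 | h2
  · refine ⟨∅, by simp, ?_⟩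
    intro a _
    rw [Finset.card_eq_zero] at h0
    have hno : ∀ x ∈ Kg, z ∉ nb x := by
      intro x hx hzx
      have := (memA x).mpr ⟨hzx, hx⟩
      rw [h0] at this
      exact absurd this (by simp)
    apply main
    · intro x hx w hw _ hzx
      exact absurd hzx (hno x hx)
    · intro _ _ h
      rw [Finset.mem_sdiff] at h
      apply h.2
      have : Kg.filter (fun w => z ∉ nb w) = Kg := by
        rw [Finset.filter_eq_self]; exact hno
      simp only [R, this]
      exact h.1
  · rw [h1]
    obtain ⟨x, hA⟩ := Finset.card_eq_one.mp h1
    have hx : z ∈ nb x ∧ x ∈ Kg := (memA x).mp (by rw [hA]; simp)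
    have hA' : ∀ y ∈ Kg, z ∈ nb y → y = x := by
      intro y hy hzy
      have := (memA y).mpr ⟨hzy, hy⟩
      rw [hA] at this
      simpa using this
    have hN : Kg.biUnion M ⊆ M x ∪ R := by
      intro b hb
      rw [Finset.mem_biUnion] at hb
      obtain ⟨y, hy, hby⟩ := hb
      by_cases hyx : y = x
      · subst hyx; exact Finset.mem_union_left _ hby
      · apply Finset.mem_union_right
        rw [Finset.mem_biUnion]
        exact ⟨y, Finset.mem_filter.mpr ⟨hy, fun h => hyx (hA' y hy h)⟩, hby⟩
    by_cases hex : ∃ y ∈ Kg, y ≠ x ∧ crit x y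
    · obtain ⟨y, hy, hyx, hc⟩ := hex
      have hzy : z ∉ nb y := fun h => hyx (hA' y hy h)
      have hcy := hcrit x hx.2 y hy hyx.symm hx.1 hzy hc
      refine ⟨M x \ M y, hcy.2, ?_⟩
      intro a ha
      apply main
      · intro x' hx' w hw hxw hzx' hzw hcw
        have := hA' x' hx' hzx'
        subst this
        by_cases hwy : w = y
        · subst hwy; exact ha
        exfalso
        have hcw' := hcrit x' hx' w hw hxw hzx' hzw hcw
        have hKg : Kg = {x', y, w} := by
          symm
          apply Finset.eq_of_subset_of_card_le
          · intro b hb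
            simp only [Finset.mem_insert, Finset.mem_singleton] at hb
            rcases hb with rfl | rfl | rfl <;> assumption
          · rw [Finset.card_eq_three.mpr ⟨x', y, w, hyx.symm, hxw, fun h => hwy h.symm, rfl⟩]
            exact hK3
        have hK : Kg.card = 3 := by
          rw [hKg]
          exact Finset.card_eq_three.mpr ⟨x', y, w, hyx.symm, hxw, fun h => hwy h.symm, rfl⟩
        have hNN : Kg.biUnion M = M x' := by
          rw [hKg]
          ext b
          simp only [Finset.mem_biUnion, Finset.mem_insert, Finset.mem_singleton]
          constructor
          · rintro ⟨v, rfl | rfl | rfl, hv⟩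
            · exact hv
            · exact hcy.1 hv
            · exact hcw'.1 hv
          · intro h; exact ⟨x', Or.inl rfl, h⟩
        have t3 := i2 hK
        rw [hNN] at t3
        have u1 : M x' ∪ M y = M x' := Finset.union_eq_left.mpr hcy.1
        have u2 : M x' ∪ M w = M x' := Finset.union_eq_left.mpr hcw'.1
        simp only [crit, u1] at hc
        simp only [crit, u2] at hcw
        rcases hc with hc | ⟨z1, a1, a2, a3, a4, -⟩
        · omega
        rcases hcw with hcw | ⟨z2, b1, b2, b3, b4, -⟩
        · omega
        have hz12 : z1 = z2 := by
          by_contra hne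
          have : ({z, z1, z2} : Finset V) ⊆ nb x' := by
            intro b hb
            simp only [Finset.mem_insert, Finset.mem_singleton] at hb
            rcases hb with rfl | rfl | rfl <;> assumption
          have h5 := Finset.card_le_card this
          rw [Finset.card_eq_three.mpr ⟨z, z1, z2, fun h => a4 h.symm, fun h => b4 h.symm, hne, rfl⟩]
            at h5
          have := hnb2 x'
          omega
        subst hz12
        have : ({x', y, w} : Finset V) ⊆ nb z1 := by
          intro b hb
          simp only [Finset.mem_insert, Finset.mem_singleton] at hb
          rcases hb with rfl | rfl | rfl
          · exact hsym _ _ a1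
          · exact hsym _ _ a2
          · exact hsym _ _ b2
        have h5 := Finset.card_le_card this
        rw [← hKg] at h5
        have := hnb2 z1
        omega
      · intro _ _ h
        rw [Finset.mem_sdiff] at h
        have h6 := hN h.1
        rw [Finset.mem_union] at h6
        rcases h6 with h6 | h6
        · apply ha
          rw [Finset.mem_sdiff]
          refine ⟨h6, fun h7 => h.2 ?_⟩
          rw [Finset.mem_biUnion]
          exact ⟨y, Finset.mem_filter.mpr ⟨hy, hzy⟩, h7⟩
        · exact h.2 h6
    · push Not at hex
      have first : ∀ a, ∀ x' ∈ Kg, ∀ w ∈ Kg, x' ≠ w → z ∈ nb x' → z ∉ nb w → crit x' w →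
          a ∉ M x' \ M w := by
        intro a x' hx' w hw hxw hzx' hzw hcw
        have := hA' x' hx' hzx'
        subst this
        exact absurd hcw (hex w hw hxw.symm)
      by_cases htr : Kg.card = 3 ∧ (Kg.biUnion M).card ≤ k
      · refine ⟨Kg.biUnion M \ R, ?_, ?_⟩
        · have hc2 : (Kg.erase x).card = 2 := by
            rw [Finset.card_erase_of_mem hx.2]; omega
          obtain ⟨y, w, hyw, hE⟩ := Finset.card_eq_two.mp hc2
          have hy : y ∈ Kg.erase x := by rw [hE]; simp
          have hw : w ∈ Kg.erase x := by rw [hE]; simp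
          rw [Finset.mem_erase] at hy hw
          have q := (i1 y hy.2 w hw.2 hyw).1
          have : M y ∪ M w ⊆ R := by
            apply Finset.union_subset
            · apply Finset.subset_biUnion_of_mem M
              exact Finset.mem_filter.mpr ⟨hy.2, fun h => hy.1 (hA' y hy.2 h)⟩
            · apply Finset.subset_biUnion_of_mem M
              exact Finset.mem_filter.mpr ⟨hw.2, fun h => hw.1 (hA' w hw.2 h)⟩
          have q2 := Finset.card_le_card this
          have hRN : R ⊆ Kg.biUnion M := Finset.biUnion_subset_biUnion_of_subset_left _
            (Finset.filter_subset _ _)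
          rw [Finset.card_sdiff_of_subset hRN]
          omega
        · intro a ha
          exact main a (first a) (fun _ _ => ha)
      · refine ⟨∅, by simp, ?_⟩
        intro a _
        exact main a (first a) (fun h3 h4 => absurd ⟨h3, h4⟩ htr)
  · rw [h2]
    obtain ⟨x, y, hxy, hA⟩ := Finset.card_eq_two.mp h2
    have hx : z ∈ nb x ∧ x ∈ Kg := (memA x).mp (by rw [hA]; simp)
    have hy : z ∈ nb y ∧ y ∈ Kg := (memA y).mp (by rw [hA]; simp)
    have hA' : ∀ y' ∈ Kg, z ∈ nb y' → y' = x ∨ y' = y := by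
      intro y' hy' hzy
      have := (memA y').mpr ⟨hzy, hy'⟩
      rw [hA] at this
      simpa using this
    by_cases hw : ∃ w ∈ Kg, z ∉ nb w
    · obtain ⟨w, hw, hzw⟩ := hw
      have hwx : x ≠ w := fun h => hzw (h ▸ hx.1)
      have hwy : y ≠ w := fun h => hzw (h ▸ hy.1)
      have hKg : Kg = {x, y, w} := by
        symm
        apply Finset.eq_of_subset_of_card_le
        · intro b hb
          simp only [Finset.mem_insert, Finset.mem_singleton] at hb
          rcases hb with rfl | rfl | rfl
          · exact hx.2
          · exact hy.2
          · exact hw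
        · rw [Finset.card_eq_three.mpr ⟨x, y, w, hxy, hwx, hwy, rfl⟩]
          exact hK3
      have huniq : ∀ w' ∈ Kg, z ∉ nb w' → w' = w := by
        intro w' hw' hz'
        rw [hKg] at hw'
        simp only [Finset.mem_insert, Finset.mem_singleton] at hw'
        rcases hw' with rfl | rfl | rfl
        · exact absurd hx.1 hz'
        · exact absurd hy.1 hz'
        · rfl
      have hRw : R = M w := by
        have : Kg.filter (fun w => z ∉ nb w) = {w} := by
          ext b
          rw [Finset.mem_filter, Finset.mem_singleton]
          exact ⟨fun h => huniq b h.1 h.2, fun h => h ▸ ⟨hw, hzw⟩⟩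
        simp only [R, this, Finset.singleton_biUnion]
      by_cases htr : Kg.card = 3 ∧ (Kg.biUnion M).card ≤ k
      · have hwN : M w ⊆ Kg.biUnion M := Finset.subset_biUnion_of_mem M hw
        refine ⟨Kg.biUnion M \ M w, ?_, ?_⟩
        · rw [Finset.card_sdiff_of_subset hwN]
          have := m2 w hw
          omega
        · intro a ha
          apply main
          · intro x' hx' w' hw' _ hzx' hzw' _ h
            have := huniq w' hw' hzw'
            subst this
            apply ha
            rw [Finset.mem_sdiff] at h ⊢
            exact ⟨Finset.subset_biUnion_of_mem M hx' h.1, h.2⟩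
          · intro _ _
            rw [hRw]; exact ha
      · let F : V → Finset ℕ := fun x => if crit x w then M x \ M w else ∅
        have hF : ∀ x ∈ Kg, z ∈ nb x → (F x).card ≤ 1 := by
          intro x hx hzx
          simp only [F]
          split_ifs with h
          · exact (hcrit x hx w hw (fun h => hzw (h ▸ hzx)) hzx hzw h).2
          · simp
        refine ⟨F x ∪ F y, ?_, ?_⟩
        · have := Finset.card_union_le (F x) (F y)
          have := hF x hx.2 hx.1
          have := hF y hy.2 hy.1
          omega
        · intro a ha
          rw [Finset.mem_union, not_or] at ha
          apply main
          · intro x' hx' w' hw' _ hzx' hzw' hc h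
            have := huniq w' hw' hzw'
            subst this
            rcases hA' x' hx' hzx' with rfl | rfl
            · apply ha.1
              simp only [F, if_pos hc]; exact h
            · apply ha.2
              simp only [F, if_pos hc]; exact h
          · intro h3 h4
            exact absurd ⟨h3, h4⟩ htr
    · push Not at hw
      refine ⟨∅, by simp, ?_⟩
      intro a _
      apply main
      · intro x' _ w' hw' _ _ hzw'
        exact absurd (hw w' hw') hzw'
      · intro h3 _
        exfalso
        have : Kg ⊆ {x, y} := by
          intro b hb
          have := hA' b hb (hw b hb)
          simpa using this
        have := Finset.card_le_card this
        have := Finset.card_le_two (a := x) (b := y)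
        omega

/-- static data: leaf adjacency, cores and lists -/
structure CoreData (V : Type*) [Fintype V] where
  nb : V → Finset V
  K : V → Finset V
  L : V → Finset ℕ
  k : ℕ
  sym : ∀ x y, y ∈ nb x → x ∈ nb y
  irr : ∀ x, x ∉ nb x
  nb2 : ∀ x, (nb x).card ≤ 2
  K3 : ∀ g, (K g).card ≤ 3
  Kdisj : ∀ g h x, x ∈ K g → x ∈ K h → g = h
  Kind : ∀ g h x y, x ∈ K g → y ∈ K h → y ∉ nb x
  hcom : ∀ g, ∀ x ∈ K g, ∀ y ∈ K g, x ≠ y → ∀ z z', z ∈ nb x → z ∈ nb y → z' ∈ nb x →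
    z' ∈ nb y → z = z'
  hL : ∀ x, k ≤ (L x).card

/-- remaining list at `x` after removing colours of coloured neighbours -/
noncomputable def Mset {V : Type*} [Fintype V] (D : CoreData V) (c : V → ℕ) (Z : Finset V) (x : V) : Finset ℕ :=
  D.L x \ ((D.nb x).filter (fun y => y ∈ Z)).image c

/-- the global invariant -/
def CInv {V : Type*} [Fintype V] (D : CoreData V) (c : V → ℕ) (Z : Finset V) : Prop :=
  ∀ g, (∀ x ∈ D.K g, x ∉ Z) → GInv D.nb D.k (D.K g) Z (Mset D c Z)

lemma Mset_card {V : Type*} [Fintype V] (D : CoreData V) (c : V → ℕ) (Z : Finset V) (x : V) :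
    D.k ≤ (Mset D c Z x).card + ((D.nb x).filter (fun y => y ∈ Z)).card := by
  have h1 := Finset.le_card_sdiff (((D.nb x).filter (fun y => y ∈ Z)).image c) (D.L x)
  have h2 := Finset.card_image_le (s := (D.nb x).filter (fun y => y ∈ Z)) (f := c)
  have h3 := D.hL x
  unfold Mset
  omega

lemma Mset_empty {V : Type*} [Fintype V] (D : CoreData V) (c : V → ℕ) (x : V) :
    Mset D c ∅ x = D.L x := by
  simp [Mset]

lemma CInv_init {V : Type*} [Fintype V] (D : CoreData V) (c : V → ℕ) : CInv D c ∅ := by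
  intro g _
  have hm : ∀ x, D.k ≤ (Mset D c ∅ x).card := fun x => by rw [Mset_empty]; exact D.hL x
  refine ⟨?_, ?_⟩
  · intro x _ y _ _
    have h1 := Finset.card_le_card
      (Finset.subset_union_left : Mset D c ∅ x ⊆ Mset D c ∅ x ∪ Mset D c ∅ y)
    have h2 := hm x
    exact ⟨by omega, fun _ _ _ _ => by omega⟩
  · intro h3
    obtain ⟨x, hx⟩ : (D.K g).Nonempty := by rw [← Finset.card_pos]; omega
    exact (hm x).trans (Finset.card_le_card (Finset.subset_biUnion_of_mem _ hx))

lemma Mset_update {V : Type*} [Fintype V] (D : CoreData V) (c : V → ℕ) (Z : Finset V) (z : V)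
    (hz : z ∉ Z) (a : ℕ) (x : V) :
    Mset D (Function.update c z a) (insert z Z) x =
      if z ∈ D.nb x then (Mset D c Z x).erase a else Mset D c Z x := by
  ext b
  have hmem : b ∈ Mset D (Function.update c z a) (insert z Z) x ↔
      b ∈ D.L x ∧ ∀ y ∈ D.nb x, y ∈ insert z Z → Function.update c z a y ≠ b := by
    simp only [Mset, Finset.mem_sdiff, Finset.mem_image, Finset.mem_filter, not_exists, not_and,
      and_imp]
  have hmem2 : b ∈ Mset D c Z x ↔ b ∈ D.L x ∧ ∀ y ∈ D.nb x, y ∈ Z → c y ≠ b := by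
    simp only [Mset, Finset.mem_sdiff, Finset.mem_image, Finset.mem_filter, not_exists, not_and,
      and_imp]
  have hupd : ∀ y ∈ Z, Function.update c z a y = c y := by
    intro y hy
    have hyz : y ≠ z := fun h => hz (h ▸ hy)
    exact Function.update_of_ne hyz _ _
  rw [hmem]
  split_ifs with h
  · rw [Finset.mem_erase, hmem2]
    constructor
    · rintro ⟨h1, h2⟩
      refine ⟨?_, h1, ?_⟩
      · have := h2 z h (by simp)
        rw [Function.update_self] at this
        exact this.symm
      · intro y hy hyZ
        have := h2 y hy (by simp [hyZ])
        rwa [hupd y hyZ] at this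
    · rintro ⟨h1, h2, h3⟩
      refine ⟨h2, ?_⟩
      intro y hy hyZ
      rw [Finset.mem_insert] at hyZ
      rcases hyZ with rfl | hyZ
      · rw [Function.update_self]; exact h1.symm
      · rw [hupd y hyZ]; exact h3 y hy hyZ
  · rw [hmem2]
    constructor
    · rintro ⟨h1, h2⟩
      refine ⟨h1, ?_⟩
      intro y hy hyZ
      have := h2 y hy (by simp [hyZ])
      rwa [hupd y hyZ] at this
    · rintro ⟨h1, h2⟩
      refine ⟨h1, ?_⟩
      intro y hy hyZ
      rw [Finset.mem_insert] at hyZ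
      rcases hyZ with rfl | hyZ
      · exact absurd hy h
      · rw [hupd y hyZ]; exact h2 y hy hyZ

lemma CInv_step {V : Type*} [Fintype V] (D : CoreData V) (c : V → ℕ) (Z : Finset V)
    (hinv : CInv D c Z) (z : V) (hz : z ∉ Z) :
    ∃ Bd : Finset ℕ, Bd.card ≤ 2 ∧ ∀ a ∉ Bd, CInv D (Function.update c z a) (insert z Z) ∧
      ∀ y ∈ D.nb z, y ∈ Z → a ≠ c y := by
  have hex : ∀ g, ∃ E : Finset ℕ, (∀ x ∈ D.K g, x ∉ Z) → E.card ≤ (D.nb z ∩ D.K g).card ∧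
      ∀ a ∉ E, GInv D.nb D.k (D.K g) (insert z Z)
        (fun x => if z ∈ D.nb x then (Mset D c Z x).erase a else Mset D c Z x) := by
    intro g
    by_cases hg : ∀ x ∈ D.K g, x ∉ Z
    · obtain ⟨E, hE⟩ := ginv_step D.nb D.k (D.K g) Z (Mset D c Z) D.sym D.nb2 (D.K3 g)
        (by
          intro x _
          have h1 := Mset_card D c Z x
          have h2 := Finset.card_le_card (Finset.filter_subset (fun y => y ∈ Z) (D.nb x))
          have h3 := D.nb2 x
          omega)
        (by
          intro x _ y hy hyZ
          have h1 := Mset_card D c Z x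
          have h2 : (D.nb x).filter (fun y => y ∈ Z) ⊆ (D.nb x).erase y := by
            intro w hw
            rw [Finset.mem_filter] at hw
            rw [Finset.mem_erase]
            exact ⟨fun h => hyZ (h ▸ hw.2), hw.1⟩
          have h2 := Finset.card_le_card h2
          rw [Finset.card_erase_of_mem hy] at h2
          have h3 := D.nb2 x
          omega)
        (by
          intro x _ y hy y' hy' hyZ hyZ' hne
          have h1 := Mset_card D c Z x
          have h2 : (D.nb x).filter (fun y => y ∈ Z) ⊆ ((D.nb x).erase y).erase y' := by
            intro w hw
            rw [Finset.mem_filter] at hw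
            rw [Finset.mem_erase, Finset.mem_erase]
            exact ⟨fun h => hyZ' (h ▸ hw.2), fun h => hyZ (h ▸ hw.2), hw.1⟩
          have h2 := Finset.card_le_card h2
          rw [Finset.card_erase_of_mem (Finset.mem_erase.mpr ⟨hne.symm, hy'⟩),
            Finset.card_erase_of_mem hy] at h2
          have h3 := D.nb2 x
          omega)
        (D.hcom g) (hinv g hg) z hz
      exact ⟨E, fun _ => hE⟩
    · exact ⟨∅, fun h => absurd h hg⟩
  choose E hE using hex
  let G : Finset V := Finset.univ.filter (fun g => ∀ x ∈ D.K g, x ∉ Z)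
  refine ⟨((D.nb z).filter (fun y => y ∈ Z)).image c ∪ G.biUnion E, ?_, ?_⟩
  · have h1 := Finset.card_union_le (((D.nb z).filter (fun y => y ∈ Z)).image c) (G.biUnion E)
    have h2 := Finset.card_image_le (s := (D.nb z).filter (fun y => y ∈ Z)) (f := c)
    have h3 : (G.biUnion E).card ≤ (G.biUnion (fun g => D.nb z ∩ D.K g)).card := by
      have hcb : (G.biUnion (fun g => D.nb z ∩ D.K g)).card = ∑ g ∈ G, (D.nb z ∩ D.K g).card := by
        apply Finset.card_biUnion
        intro g _ h _ hne
        rw [Function.onFun, Finset.disjoint_left]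
        intro x hx hx'
        exact hne (D.Kdisj g h x (Finset.mem_inter.mp hx).2 (Finset.mem_inter.mp hx').2)
      rw [hcb]
      refine Finset.card_biUnion_le.trans (Finset.sum_le_sum ?_)
      intro g hg
      exact (hE g (Finset.mem_filter.mp hg).2).1
    have h4 : ((D.nb z).filter (fun y => y ∈ Z)).card +
        (G.biUnion (fun g => D.nb z ∩ D.K g)).card ≤ (D.nb z).card := by
      rw [← Finset.card_union_of_disjoint]
      · apply Finset.card_le_card
        apply Finset.union_subset (Finset.filter_subset _ _)
        intro x hx
        rw [Finset.mem_biUnion] at hx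
        obtain ⟨g, _, hx⟩ := hx
        exact (Finset.mem_inter.mp hx).1
      · rw [Finset.disjoint_left]
        intro x hx hx'
        rw [Finset.mem_biUnion] at hx'
        obtain ⟨g, hg, hx'⟩ := hx'
        exact (Finset.mem_filter.mp hg).2 x (Finset.mem_inter.mp hx').2 (Finset.mem_filter.mp hx).2
    have h5 := D.nb2 z
    omega
  · intro a ha
    rw [Finset.mem_union, not_or] at ha
    refine ⟨?_, ?_⟩
    · intro g hg
      have hg' : ∀ x ∈ D.K g, x ∉ Z := fun x hx h => hg x hx (Finset.mem_insert_of_mem h)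
      have := (hE g hg').2 a (fun h => ha.2 (Finset.mem_biUnion.mpr
        ⟨g, Finset.mem_filter.mpr ⟨Finset.mem_univ _, hg'⟩, h⟩))
      convert this using 2 with x
      exact Mset_update D c Z z hz a x
    · intro y hy hyZ h
      apply ha.1
      rw [h]
      exact Finset.mem_image_of_mem c (Finset.mem_filter.mpr ⟨hy, hyZ⟩)

lemma CInv_free {V : Type*} [Fintype V] (D : CoreData V) (c c' : V → ℕ) (Z A : Finset V)
    (hinv : CInv D c Z) (hA : ∀ g, ∀ y ∈ D.K g, ∀ x ∈ A, x ∉ D.nb y)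
    (hc : ∀ x ∉ A, c' x = c x) : CInv D c' (Z ∪ A) := by
  intro g hg
  have hM : ∀ x ∈ D.K g, Mset D c' (Z ∪ A) x = Mset D c Z x := by
    intro x hx
    unfold Mset
    congr 1
    have e1 : (D.nb x).filter (fun y => y ∈ Z ∪ A) = (D.nb x).filter (fun y => y ∈ Z) := by
      apply Finset.filter_congr
      intro y hy
      rw [Finset.mem_union]
      exact ⟨fun h => h.resolve_right (fun h' => hA g x hx y h' hy), Or.inl⟩
    rw [e1]
    apply Finset.image_congr
    intro y hy
    apply hc
    intro hyA
    exact hA g x hx y hyA (Finset.mem_filter.mp hy).1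
  obtain ⟨i1, i2⟩ := hinv g (fun x hx h => hg x hx (Finset.mem_union_left _ h))
  refine ⟨?_, ?_⟩
  · intro x hx y hy hxy
    rw [hM x hx, hM y hy]
    refine ⟨(i1 x hx y hy hxy).1, ?_⟩
    intro z h1 h2 h3
    exact (i1 x hx y hy hxy).2 z h1 h2 (fun h => h3 (Finset.mem_union_left _ h))
  · intro h3
    rw [Finset.biUnion_congr rfl hM]
    exact i2 h3

/-- what the colours of the set `A` have to satisfy -/
def KidsOk {V : Type*} [Fintype V] (D : CoreData V) (c : V → ℕ) (Z : Finset V) (P : Finset ℕ)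
    (A : Finset V) : Prop :=
  (∀ x ∈ A, c x ∈ D.L x ∧ c x ∉ P) ∧ (∀ x ∈ A, ∀ y ∈ A, x ≠ y → c x ≠ c y) ∧
    (∀ x ∈ A, ∀ y ∈ D.nb x, y ∈ Z ∪ A → c x ≠ c y)

lemma stage1 {V : Type*} [Fintype V] (D : CoreData V) (c : V → ℕ) (Z : Finset V) (P : Finset ℕ)
    (hinv : CInv D c Z) (A : Finset V) :
    (∀ x ∈ A, x ∉ Z) → A.card + 2 + P.card ≤ D.k →
    ∃ c' : V → ℕ, (∀ x ∉ A, c' x = c x) ∧ CInv D c' (Z ∪ A) ∧ KidsOk D c' Z P A := by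
  induction A using Finset.induction_on with
  | empty =>
    intro _ _
    exact ⟨c, fun _ _ => rfl, by simpa using hinv, by simp, by simp, by simp⟩
  | insert z A hzA ih =>
    intro hAZ hcard
    rw [Finset.card_insert_of_notMem hzA] at hcard
    obtain ⟨c1, h1, h2, h3, h4, h5⟩ := ih (fun x hx => hAZ x (Finset.mem_insert_of_mem hx))
      (by omega)
    have hz : z ∉ Z ∪ A := by
      rw [Finset.mem_union, not_or]
      exact ⟨hAZ z (Finset.mem_insert_self _ _), hzA⟩
    obtain ⟨Bd, hB, hBd⟩ := CInv_step D c1 (Z ∪ A) h2 z hz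
    obtain ⟨a, haL, ha⟩ := exists_avoid (D.L z) (P ∪ A.image c1 ∪ Bd) (by
      have q1 := Finset.card_union_le (P ∪ A.image c1) Bd
      have q2 := Finset.card_union_le P (A.image c1)
      have q3 := Finset.card_image_le (s := A) (f := c1)
      have q4 := D.hL z
      omega)
    simp only [Finset.mem_union, not_or] at ha
    obtain ⟨⟨ha1, ha2⟩, ha3⟩ := ha
    obtain ⟨g1, g2⟩ := hBd a ha3
    have upd : ∀ x, x ≠ z → Function.update c1 z a x = c1 x := fun x hx =>
      Function.update_of_ne hx _ _
    have hne : ∀ x ∈ A, x ≠ z := fun x hx h => hzA (h ▸ hx)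
    have hmem : ∀ y, y ∈ Z ∪ A → y ≠ z := fun y hy h => hz (h ▸ hy)
    refine ⟨Function.update c1 z a, ?_, ?_, ?_, ?_, ?_⟩
    · intro x hx
      rw [Finset.mem_insert, not_or] at hx
      rw [upd x hx.1, h1 x hx.2]
    · rw [Finset.union_insert]; exact g1
    · intro x hx
      rw [Finset.mem_insert] at hx
      rcases hx with rfl | hx
      · rw [Function.update_self]; exact ⟨haL, ha1⟩
      · rw [upd x (hne x hx)]; exact h3 x hx
    · have key : ∀ x ∈ A, a ≠ c1 x := fun x hx h => ha2 (h ▸ Finset.mem_image_of_mem c1 hx)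
      intro x hx y hy hxy
      rw [Finset.mem_insert] at hx hy
      rcases hx with rfl | hx
      · rcases hy with rfl | hy
        · exact absurd rfl hxy
        · rw [Function.update_self, upd y (hne y hy)]; exact key y hy
      · rcases hy with rfl | hy
        · rw [Function.update_self, upd x (hne x hx)]; exact (key x hx).symm
        · rw [upd x (hne x hx), upd y (hne y hy)]; exact h4 x hx y hy hxy
    · intro x hx y hy hyZ
      have hyZ' : y = z ∨ y ∈ Z ∪ A := by
        rw [Finset.union_insert, Finset.mem_insert] at hyZ; exact hyZ
      rw [Finset.mem_insert] at hx
      rcases hx with rfl | hx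
      · rcases hyZ' with rfl | hyZ'
        · exact absurd hy (D.irr _)
        · rw [Function.update_self, upd y (hmem y hyZ')]; exact g2 y hy hyZ'
      · rcases hyZ' with rfl | hyZ'
        · rw [Function.update_self, upd x (hne x hx)]
          exact (g2 x (D.sym _ _ hy) (Finset.mem_union_right _ hx)).symm
        · rw [upd x (hne x hx), upd y (hmem y hyZ')]; exact h5 x hx y hy hyZ'

lemma stage2 {V : Type*} [Fintype V] (D : CoreData V) (c : V → ℕ) (Z : Finset V) (P : Finset ℕ)
    (hinv : CInv D c Z) (u : V) (hZ : ∀ x ∈ D.K u, x ∉ Z)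
    (hk : D.K u = ∅ ∨ P.card + 3 ≤ D.k) :
    ∃ c' : V → ℕ, (∀ x ∉ D.K u, c' x = c x) ∧ CInv D c' (Z ∪ D.K u) ∧
      KidsOk D c' Z P (D.K u) := by
  rcases hk with hk | hk
  · rw [hk]
    exact ⟨c, fun _ _ => rfl, by simpa using hinv, by simp, by simp, by simp⟩
  obtain ⟨i1, i2⟩ := hinv u hZ
  let t : {x // x ∈ D.K u} → Finset ℕ := fun x => Mset D c Z x \ P
  have hall : ∀ S : Finset {x // x ∈ D.K u}, S.card ≤ (S.biUnion t).card := by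
    intro S
    have hun : S.biUnion t = (S.image Subtype.val).biUnion (Mset D c Z) \ P := by
      ext b
      simp only [t, Finset.mem_biUnion, Finset.mem_sdiff, Finset.mem_image]
      constructor
      · rintro ⟨x, hx, h1, h2⟩
        exact ⟨⟨x, ⟨x, hx, rfl⟩, h1⟩, h2⟩
      · rintro ⟨⟨_, ⟨x, hx, rfl⟩, h1⟩, h2⟩
        exact ⟨x, hx, h1, h2⟩
    have hSc : (S.image Subtype.val).card = S.card :=
      Finset.card_image_of_injective _ Subtype.val_injective
    have hSK : S.image Subtype.val ⊆ D.K u := by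
      intro x hx
      obtain ⟨y, _, rfl⟩ := Finset.mem_image.mp hx
      exact y.2
    rw [hun, ← hSc]
    generalize S.image Subtype.val = S' at hSK
    have h3 : S'.card ≤ 3 := (Finset.card_le_card hSK).trans (D.K3 u)
    have h4 := Finset.le_card_sdiff P (S'.biUnion (Mset D c Z))
    suffices hs : S'.card = 0 ∨ D.k + S'.card ≤ (S'.biUnion (Mset D c Z)).card + 3 by omega
    rcases (by omega : S'.card = 0 ∨ S'.card = 1 ∨ S'.card = 2 ∨ S'.card = 3) with h | h | h | h
    · exact Or.inl h
    · right
      obtain ⟨x, rfl⟩ := Finset.card_eq_one.mp h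
      rw [Finset.singleton_biUnion]
      have q1 := Mset_card D c Z x
      have q2 := Finset.card_le_card (Finset.filter_subset (fun y => y ∈ Z) (D.nb x))
      have q3 := D.nb2 x
      omega
    · right
      obtain ⟨x, y, hxy, rfl⟩ := Finset.card_eq_two.mp h
      have := (i1 x (hSK (by simp)) y (hSK (by simp)) hxy).1
      rw [Finset.biUnion_insert, Finset.singleton_biUnion]
      omega
    · right
      have hK3 := D.K3 u
      have : S' = D.K u := Finset.eq_of_subset_of_card_le hSK (by omega)
      subst this
      have := i2 h
      omega
  obtain ⟨f, finj, hf⟩ := (Finset.all_card_le_biUnion_card_iff_exists_injective t).mp hall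
  let c' : V → ℕ := fun x => if h : x ∈ D.K u then f ⟨x, h⟩ else c x
  have hc' : ∀ x ∉ D.K u, c' x = c x := fun x hx => dif_neg hx
  have hc1 : ∀ x (h : x ∈ D.K u), c' x = f ⟨x, h⟩ := fun x h => dif_pos h
  refine ⟨c', hc', ?_, ?_, ?_, ?_⟩
  · apply CInv_free D c c' Z (D.K u) hinv _ hc'
    intro g y hy x hx
    exact D.Kind g u y x hy hx
  · intro x hx
    rw [hc1 x hx]
    have := hf ⟨x, hx⟩
    simp only [t, Mset, Finset.mem_sdiff] at this
    exact ⟨this.1.1, this.2⟩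
  · intro x hx y hy hxy h
    rw [hc1 x hx, hc1 y hy] at h
    have := finj h
    simp only [Subtype.mk.injEq] at this
    exact hxy this
  · intro x hx y hy hyZ h
    have hyK : y ∉ D.K u := fun hyK => D.Kind u u x y hx hyK hy
    have hyZ' : y ∈ Z := by
      rw [Finset.mem_union] at hyZ
      exact hyZ.resolve_right hyK
    rw [hc1 x hx, hc' y hyK] at h
    have := hf ⟨x, hx⟩
    simp only [t, Mset, Finset.mem_sdiff] at this
    apply this.1.2
    rw [h]
    exact Finset.mem_image_of_mem c (Finset.mem_filter.mpr ⟨hy, hyZ'⟩)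

lemma stage3 {V : Type*} [Fintype V] (D : CoreData V) (c : V → ℕ) (Z : Finset V) (P : Finset ℕ)
    (hinv : CInv D c Z) (A : Finset V) :
    (∀ x ∈ A, D.nb x = ∅) → A.card + P.card ≤ D.k →
    ∃ c' : V → ℕ, (∀ x ∉ A, c' x = c x) ∧ CInv D c' (Z ∪ A) ∧ KidsOk D c' Z P A := by
  intro hnb hcard
  have : ∃ c' : V → ℕ, (∀ x ∉ A, c' x = c x) ∧ (∀ x ∈ A, c' x ∈ D.L x ∧ c' x ∉ P) ∧
      (∀ x ∈ A, ∀ y ∈ A, x ≠ y → c' x ≠ c' y) := by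
    clear hnb
    induction A using Finset.induction_on with
    | empty => exact ⟨c, fun _ _ => rfl, by simp, by simp⟩
    | insert z A hzA ih =>
      rw [Finset.card_insert_of_notMem hzA] at hcard
      obtain ⟨c1, h1, h3, h4⟩ := ih (by omega)
      obtain ⟨a, haL, ha⟩ := exists_avoid (D.L z) (P ∪ A.image c1) (by
        have q2 := Finset.card_union_le P (A.image c1)
        have q3 := Finset.card_image_le (s := A) (f := c1)
        have q4 := D.hL z
        omega)
      simp only [Finset.mem_union, not_or] at ha
      obtain ⟨ha1, ha2⟩ := ha
      have upd : ∀ x, x ≠ z → Function.update c1 z a x = c1 x := fun x hx =>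
        Function.update_of_ne hx _ _
      have hne : ∀ x ∈ A, x ≠ z := fun x hx h => hzA (h ▸ hx)
      refine ⟨Function.update c1 z a, ?_, ?_, ?_⟩
      · intro x hx
        rw [Finset.mem_insert, not_or] at hx
        rw [upd x hx.1, h1 x hx.2]
      · intro x hx
        rw [Finset.mem_insert] at hx
        rcases hx with rfl | hx
        · rw [Function.update_self]; exact ⟨haL, ha1⟩
        · rw [upd x (hne x hx)]; exact h3 x hx
      · have key : ∀ x ∈ A, a ≠ c1 x := fun x hx h => ha2 (h ▸ Finset.mem_image_of_mem c1 hx)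
        intro x hx y hy hxy
        rw [Finset.mem_insert] at hx hy
        rcases hx with rfl | hx
        · rcases hy with rfl | hy
          · exact absurd rfl hxy
          · rw [Function.update_self, upd y (hne y hy)]; exact key y hy
        · rcases hy with rfl | hy
          · rw [Function.update_self, upd x (hne x hx)]; exact (key x hx).symm
          · rw [upd x (hne x hx), upd y (hne y hy)]; exact h4 x hx y hy hxy
  obtain ⟨c', h1, h2, h3⟩ := this
  refine ⟨c', h1, ?_, h2, h3, ?_⟩
  · apply CInv_free D c c' Z A hinv _ h1
    intro g y _ x hx hxy
    have := D.sym _ _ hxy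
    rw [hnb x hx] at this
    exact absurd this (by simp)
  · intro x hx y hy
    rw [hnb x hx] at hy
    exact absurd hy (by simp)

/-- combine two stages -/
lemma KidsOk_union {V : Type*} [Fintype V] (D : CoreData V) (c c' : V → ℕ) (Z : Finset V)
    (P : Finset ℕ) (A B : Finset V) (hAB : Disjoint A B)
    (hA : KidsOk D c Z P A) (hc : ∀ x ∉ B, c' x = c x)
    (hB : KidsOk D c' (Z ∪ A) (P ∪ A.image c) B) : KidsOk D c' Z P (A ∪ B) := by
  obtain ⟨a1, a2, a3⟩ := hA
  obtain ⟨b1, b2, b3⟩ := hB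
  have hAB' : ∀ x ∈ A, x ∉ B := fun x hx => Finset.disjoint_left.mp hAB hx
  have key : ∀ x ∈ A, ∀ y ∈ B, c' x ≠ c' y := by
    intro x hx y hy h
    have := (b1 y hy).2
    rw [Finset.mem_union, not_or] at this
    apply this.2
    rw [← h, hc x (hAB' x hx)]
    exact Finset.mem_image_of_mem c hx
  refine ⟨?_, ?_, ?_⟩
  · intro x hx
    rw [Finset.mem_union] at hx
    rcases hx with hx | hx
    · rw [hc x (hAB' x hx)]; exact a1 x hx
    · have := b1 x hx
      exact ⟨this.1, fun h => this.2 (Finset.mem_union_left _ h)⟩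
  · intro x hx y hy hxy
    rw [Finset.mem_union] at hx hy
    rcases hx with hx | hx <;> rcases hy with hy | hy
    · rw [hc x (hAB' x hx), hc y (hAB' y hy)]; exact a2 x hx y hy hxy
    · exact key x hx y hy
    · exact (key y hy x hx).symm
    · exact b2 x hx y hy hxy
  · intro x hx y hy hyZ
    rw [Finset.mem_union] at hx
    rw [← Finset.union_assoc] at hyZ
    rcases hx with hx | hx
    · by_cases hyB : y ∈ B
      · exact key x hx y hyB
      · rw [hc x (hAB' x hx), hc y hyB]
        apply a3 x hx y hy
        rw [Finset.mem_union] at hyZ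
        exact hyZ.resolve_right hyB
    · exact b3 x hx y hy hyZ

lemma step_all {V : Type*} [Fintype V] (D : CoreData V) (c : V → ℕ) (Z : Finset V) (P : Finset ℕ)
    (hinv : CInv D c Z) (u : V) (Nc NL : Finset V)
    (hZ1 : ∀ x ∈ Nc, x ∉ Z) (hZ2 : ∀ x ∈ D.K u, x ∉ Z)
    (hd1 : Disjoint Nc (D.K u)) (hd2 : Disjoint Nc NL) (hd3 : Disjoint (D.K u) NL)
    (hnb : ∀ x ∈ NL, D.nb x = ∅)
    (k1 : Nc.card + 2 + P.card ≤ D.k) (k2 : D.K u = ∅ ∨ Nc.card + 3 + P.card ≤ D.k)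
    (k3 : P.card + Nc.card + (D.K u).card + NL.card ≤ D.k) :
    ∃ c' : V → ℕ, (∀ x ∉ Nc ∪ D.K u ∪ NL, c' x = c x) ∧ CInv D c' (Z ∪ (Nc ∪ D.K u ∪ NL)) ∧
      KidsOk D c' Z P (Nc ∪ D.K u ∪ NL) := by
  obtain ⟨c1, a1, a2, a3⟩ := stage1 D c Z P hinv Nc hZ1 k1
  have q1 := Finset.card_union_le P (Nc.image c1)
  have q2 := Finset.card_image_le (s := Nc) (f := c1)
  obtain ⟨c2, b1, b2, b3⟩ := stage2 D c1 (Z ∪ Nc) (P ∪ Nc.image c1) a2 u (by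
    intro x hx h
    rw [Finset.mem_union] at h
    rcases h with h | h
    · exact hZ2 x hx h
    · exact Finset.disjoint_left.mp hd1 h hx) (by
    rcases k2 with k2 | k2
    · exact Or.inl k2
    · right; omega)
  have b4 := KidsOk_union D c1 c2 Z P Nc (D.K u) hd1 a3 b1 b3
  rw [Finset.union_assoc] at b2
  have q3 := Finset.card_union_le P ((Nc ∪ D.K u).image c2)
  have q4 := Finset.card_image_le (s := Nc ∪ D.K u) (f := c2)
  have q5 := Finset.card_union_le Nc (D.K u)
  obtain ⟨c3, d1, d2, d3⟩ := stage3 D c2 (Z ∪ (Nc ∪ D.K u)) (P ∪ (Nc ∪ D.K u).image c2) b2 NL hnb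
    (by omega)
  have d4 := KidsOk_union D c2 c3 Z P (Nc ∪ D.K u) NL
    (by rw [Finset.disjoint_union_left]; exact ⟨hd2, hd3⟩) b4 d1 d3
  rw [Finset.union_assoc Z] at d2
  refine ⟨c3, ?_, d2, d4⟩
  intro x hx
  simp only [Finset.mem_union, not_or] at hx
  rw [d1 x hx.2, b1 x hx.1.2, a1 x hx.1.1]

/-- a rooted tree given by a parent function -/
structure RTree (V : Type*) [Fintype V] where
  r : V
  par : V → V
  dep : V → ℕ
  hdep : ∀ v, v ≠ r → dep (par v) < dep v

/-- children -/
noncomputable def RTree.ch {V : Type*} [Fintype V] (R : RTree V) (u : V) : Finset V :=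
  Finset.univ.filter (fun v => v ≠ R.r ∧ R.par v = u)

/-- degree -/
noncomputable def RTree.deg {V : Type*} [Fintype V] (R : RTree V) (u : V) : ℕ :=
  (R.ch u).card + if u = R.r then 0 else 1

/-- the colours at a vertex; the edge from `v` to its parent has colour `c v` -/
noncomputable def RTree.col {V : Type*} [Fintype V] (R : RTree V) (c : V → ℕ) (u : V) :
    Finset ℕ :=
  (R.ch u).image c ∪ if u = R.r then ∅ else {c u}

lemma RTree.mem_ch {V : Type*} [Fintype V] (R : RTree V) (u v : V) :
    v ∈ R.ch u ↔ v ≠ R.r ∧ R.par v = u := by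
  simp [RTree.ch]

lemma RTree.col_card {V : Type*} [Fintype V] (R : RTree V) (c : V → ℕ) (u : V) :
    (R.col c u).card ≤ R.deg u := by
  unfold RTree.col RTree.deg
  refine (Finset.card_union_le _ _).trans ?_
  apply Nat.add_le_add Finset.card_image_le
  split_ifs <;> simp

/-- the condition at a coloured vertex -/
def VOK {V : Type*} [Fintype V] (R : RTree V) (L : V → Finset ℕ) (c : V → ℕ)
    (O : V → Finset V) (v : V) : Prop :=
  c v ∈ L v ∧ (∀ w ∈ R.ch (R.par v), w ≠ v → c v ≠ c w ∧ (w ∈ O v ∨ v ∈ O w)) ∧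
  (R.par v ≠ R.r → c v ≠ c (R.par v) ∧ (R.par v ∈ O v ∨ c v ∉ R.col c (R.par (R.par v))) ∧
    c v ∉ (O (R.par v)).image c) ∧
  (∀ w ∈ O v, w ≠ R.r ∧ w ≠ v ∧ (R.par w = R.par v ∨ w = R.par v)) ∧
  (O v).card ≤ R.deg (R.par v) / 2

lemma RTree.col_congr {V : Type*} [Fintype V] (R : RTree V) (c c' : V → ℕ) (p : V)
    (h1 : ∀ w ∈ R.ch p, c' w = c w) (h2 : p ≠ R.r → c' p = c p) : R.col c' p = R.col c p := by
  unfold RTree.col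
  congr 1
  · apply Finset.image_congr
    intro w hw
    exact h1 w hw
  · split_ifs with h
    · rfl
    · rw [h2 h]

lemma VOK_congr {V : Type*} [Fintype V] (R : RTree V) (L : V → Finset ℕ) (c c' : V → ℕ)
    (O O' : V → Finset V) (W : Finset V) (hW : ∀ w ∈ W, w ≠ R.r → R.par w ∈ W)
    (hc : ∀ v, v ≠ R.r → R.par v ∈ W → c' v = c v)
    (hO : ∀ v, v ≠ R.r → R.par v ∈ W → O' v = O v)
    (hall : ∀ v, v ≠ R.r → R.par v ∈ W → VOK R L c O v)
    (v : V) (hv : v ≠ R.r) (hvW : R.par v ∈ W) : VOK R L c' O' v := by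
  obtain ⟨h1, h2, h3, h4, h5⟩ := hall v hv hvW
  refine ⟨?_, ?_, ?_, ?_, ?_⟩
  · rw [hc v hv hvW]; exact h1
  · intro w hw hwv
    have hw' := (R.mem_ch _ _).mp hw
    have hwW : R.par w ∈ W := hw'.2 ▸ hvW
    rw [hc v hv hvW, hc w hw'.1 hwW, hO v hv hvW, hO w hw'.1 hwW]
    exact h2 w hw hwv
  · intro hp
    obtain ⟨a1, a2, a3⟩ := h3 hp
    have hpW : R.par (R.par v) ∈ W := hW _ hvW hp
    rw [hc v hv hvW, hc _ hp hpW, hO v hv hvW, hO _ hp hpW]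
    refine ⟨a1, ?_, ?_⟩
    · rw [R.col_congr c c']
      · exact a2
      · intro w hw
        have hw' := (R.mem_ch _ _).mp hw
        exact hc w hw'.1 (hw'.2 ▸ hpW)
      · intro hpp
        exact hc _ hpp (hW _ hpW hpp)
    · have : (O (R.par v)).image c' = (O (R.par v)).image c := by
        apply Finset.image_congr
        intro w hw
        obtain ⟨-, -, -, b4, -⟩ := hall _ hp hpW
        obtain ⟨e1, -, e2⟩ := b4 w hw
        apply hc w e1
        rcases e2 with e2 | e2
        · rw [e2]; exact hpW
        · exact hW _ (e2 ▸ hpW) e1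
      rw [this]
      exact a3
  · rw [hO v hv hvW]; exact h4
  · rw [hO v hv hvW]; exact h5

/-- the state of the induction -/
def TState {V : Type*} [Fintype V] (R : RTree V) (D : CoreData V) (W : Finset V) : Prop :=
  ∃ (c : V → ℕ) (O : V → Finset V),
    (∀ v, v ≠ R.r → R.par v ∈ W → VOK R D.L c O v) ∧
    (∀ x y, x ≠ R.r → y ≠ R.r → R.par x ∈ W → R.par y ∈ W → y ∈ D.nb x → c x ≠ c y) ∧
    CInv D c (Finset.univ.filter (fun v => v ≠ R.r ∧ R.par v ∈ W))

set_option maxHeartbeats 1000000 in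
lemma tstate_step {V : Type*} [Fintype V] (R : RTree V) (D : CoreData V) (pb : V → ℕ)
    (hK : ∀ u, D.K u ⊆ (R.ch u).filter (fun x => R.ch x = ∅))
    (hnb : ∀ x, R.ch x ≠ ∅ → D.nb x = ∅)
    (hnum : ∀ u, (D.K u = ∅ ∧ ((R.ch u).filter (fun x => R.ch x = ∅)).card + 2 + pb u ≤ D.k) ∨
      (((R.ch u).filter (fun x => R.ch x = ∅)).card + 3 + pb u ≤ D.k + (D.K u).card))
    (hs : ∀ u, (R.ch u).card + pb u ≤ D.k)
    (hp1 : ∀ u, u ≠ R.r → 1 + R.deg (R.par u) / 2 ≤ pb u)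
    (hp2 : ∀ u, u ≠ R.r → R.deg (R.par u) ≤ pb u + ((R.ch u).card + 1) / 2)
    (W : Finset V) (hW : ∀ w ∈ W, w ≠ R.r → R.par w ∈ W) (hT : TState R D W)
    (u : V) (hu : u ∉ W) (hup : u ≠ R.r → R.par u ∈ W) : TState R D (insert u W) := by
  obtain ⟨c, O, hV, hN, hI⟩ := hT
  set Z := Finset.univ.filter (fun v => v ≠ R.r ∧ R.par v ∈ W) with hZ
  have memZ : ∀ v, v ∈ Z ↔ v ≠ R.r ∧ R.par v ∈ W := by intro v; simp [hZ]
  -- the sets `Cp` and `P`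
  obtain ⟨Cp, P, hCp0, hCp, hP1, hP2, hP3⟩ : ∃ Cp P : Finset ℕ, (u = R.r → Cp = ∅) ∧
      (u ≠ R.r → Cp = R.col c (R.par u)) ∧
      (u ≠ R.r → c u ∈ P ∧ (O u).image c ⊆ P) ∧ P.card ≤ pb u ∧
      (Cp \ P).card ≤ ((R.ch u).card + 1) / 2 := by
    by_cases hur : u = R.r
    · exact ⟨∅, ∅, fun _ => rfl, fun h => absurd hur h, fun h => absurd hur h, by simp, by simp⟩
    · have hpW := hup hur
      obtain ⟨v1, v2, v3, v4, v5⟩ := hV u hur hpW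
      let P0 := insert (c u) ((O u).image c)
      have hP0c : P0.card ≤ 1 + R.deg (R.par u) / 2 := by
        have := Finset.card_insert_le (c u) ((O u).image c)
        have := Finset.card_image_le (s := O u) (f := c)
        simp only [P0]
        omega
      have hsub : P0 ⊆ R.col c (R.par u) := by
        intro b hb
        simp only [P0, Finset.mem_insert, Finset.mem_image] at hb
        unfold RTree.col
        rw [Finset.mem_union]
        rcases hb with rfl | ⟨w, hw, rfl⟩
        · left
          exact Finset.mem_image_of_mem c ((R.mem_ch _ _).mpr ⟨hur, rfl⟩)
        · obtain ⟨e1, -, e2⟩ := v4 w hw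
          rcases e2 with e2 | e2
          · left
            exact Finset.mem_image_of_mem c ((R.mem_ch _ _).mpr ⟨e1, e2⟩)
          · right
            rw [← e2, if_neg e1]
            simp
      have hcc := R.col_card c (R.par u)
      have h1 := hp1 u hur
      have h2 := hp2 u hur
      have hle := Finset.card_le_card hsub
      obtain ⟨P, p1, p2, p3⟩ := Finset.exists_subsuperset_card_eq hsub
        (n := max P0.card ((R.col c (R.par u)).card - ((R.ch u).card + 1) / 2))
        (le_max_left _ _) (max_le hle (Nat.sub_le _ _))
      refine ⟨R.col c (R.par u), P, fun h => absurd h hur, fun _ => rfl, fun _ => ⟨?_, ?_⟩, ?_, ?_⟩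
      · exact p1 (Finset.mem_insert_self _ _)
      · exact (Finset.subset_insert _ _).trans p1
      · omega
      · rw [Finset.card_sdiff_of_subset p2]; omega
  -- colour the children
  have hKch : D.K u ⊆ R.ch u := (hK u).trans (Finset.filter_subset _ _)
  let lf := (R.ch u).filter (fun x => R.ch x = ∅)
  let Nc := lf \ D.K u
  let NL := (R.ch u).filter (fun x => R.ch x ≠ ∅)
  have hun : Nc ∪ D.K u ∪ NL = R.ch u := by
    rw [Finset.sdiff_union_of_subset (hK u)]
    exact Finset.filter_union_filter_not_eq _ _
  have hchZ : ∀ x ∈ R.ch u, x ∉ Z := by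
    intro x hx h
    have h1 := (R.mem_ch _ _).mp hx
    have h2 := (memZ x).mp h
    exact hu (h1.2 ▸ h2.2)
  have hNcc : Nc.card + (D.K u).card = lf.card := Finset.card_sdiff_add_card_eq_card (hK u)
  have hlfc : lf.card + NL.card = (R.ch u).card := by
    exact Finset.card_filter_add_card_filter_not _
  have hnumu := hnum u
  have hsu := hs u
  have hnumu' : (D.K u = ∅ ∧ lf.card + 2 + pb u ≤ D.k) ∨
    (lf.card + 3 + pb u ≤ D.k + (D.K u).card) := hnumu
  have hk0 : D.K u = ∅ → (D.K u).card = 0 := fun h => by rw [h]; rfl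
  obtain ⟨c', s1, s2, s3, s4, s5⟩ := step_all D c Z P hI u Nc NL
    (fun x hx => hchZ x (Finset.mem_filter.mp (Finset.mem_sdiff.mp hx).1).1)
    (fun x hx => hchZ x (hKch hx))
    Finset.sdiff_disjoint
    (by
      rw [Finset.disjoint_left]
      intro x hx hx'
      exact (Finset.mem_filter.mp hx').2 (Finset.mem_filter.mp (Finset.mem_sdiff.mp hx).1).2)
    (by
      rw [Finset.disjoint_left]
      intro x hx hx'
      exact (Finset.mem_filter.mp hx').2 (Finset.mem_filter.mp (hK u hx)).2)
    (fun x hx => hnb x (Finset.mem_filter.mp hx).2)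
    (by
      rcases hnumu' with ⟨h, h'⟩ | h
      · have := hk0 h
        omega
      · omega)
    (by
      rcases hnumu' with ⟨h, h'⟩ | h
      · exact Or.inl h
      · right; omega)
    (by omega)
  rw [hun] at s1 s2 s3 s4 s5
  -- the tournament
  let B := (R.ch u).filter (fun v => c' v ∈ Cp)
  have hB : B.card ≤ ((R.ch u).card + 1) / 2 := by
    refine le_trans ?_ hP3
    apply Finset.card_le_card_of_injOn c'
    · intro v hv
      have hv := Finset.mem_filter.mp hv
      exact Finset.mem_sdiff.mpr ⟨hv.2, (s3 v hv.1).2⟩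
    · intro v hv w hw h
      by_contra hne
      exact s4 v (Finset.mem_filter.mp hv).1 w (Finset.mem_filter.mp hw).1 hne h
  obtain ⟨Q, t1, t2, t3, t4⟩ := tour (R.ch u).card (R.ch u) B rfl (Finset.filter_subset _ _) hB
  let O' : V → Finset V := fun v => if v ∈ R.ch u then (if v ∈ B then insert u (Q v) else Q v)
    else O v
  have hcold : ∀ v, v ≠ R.r → R.par v ∈ W → c' v = c v := by
    intro v hv hvW
    apply s1
    intro h
    exact hchZ v h ((memZ v).mpr ⟨hv, hvW⟩)
  have hOold : ∀ v, v ≠ R.r → R.par v ∈ W → O' v = O v := by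
    intro v hv hvW
    apply if_neg
    intro h
    exact hchZ v h ((memZ v).mpr ⟨hv, hvW⟩)
  have hQO : ∀ v ∈ R.ch u, Q v ⊆ O' v := by
    intro v hv
    simp only [O', if_pos hv]
    split_ifs
    · exact Finset.subset_insert _ _
    · exact subset_rfl
  have hZZ : Finset.univ.filter (fun v => v ≠ R.r ∧ R.par v ∈ insert u W) = Z ∪ R.ch u := by
    ext v
    rw [Finset.mem_union, memZ, R.mem_ch]
    simp only [Finset.mem_filter, Finset.mem_univ, true_and, Finset.mem_insert]
    constructor
    · rintro ⟨h1, h2 | h2⟩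
      · exact Or.inr ⟨h1, h2⟩
      · exact Or.inl ⟨h1, h2⟩
    · rintro (⟨h1, h2⟩ | ⟨h1, h2⟩)
      · exact ⟨h1, Or.inr h2⟩
      · exact ⟨h1, Or.inl h2⟩
  refine ⟨c', O', ?_, ?_, ?_⟩
  · intro v hv hvW
    rw [Finset.mem_insert] at hvW
    rcases hvW with hvu | hvW
    swap
    · exact VOK_congr R D.L c c' O O' W hW hcold hOold hV v hv hvW
    have hvch : v ∈ R.ch u := (R.mem_ch _ _).mpr ⟨hv, hvu⟩
    unfold VOK
    rw [hvu]
    refine ⟨(s3 v hvch).1, ?_, ?_, ?_, ?_⟩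
    · intro w hw hwv
      refine ⟨s4 v hvch w hw hwv.symm, ?_⟩
      rcases t2 v hvch w hw hwv.symm with h | h
      · exact Or.inl (hQO v hvch h)
      · exact Or.inr (hQO w hw h)
    · intro hur
      have hpW := hup hur
      obtain ⟨-, -, -, v4, -⟩ := hV u hur hpW
      have hcu : c' u = c u := hcold u hur hpW
      refine ⟨?_, ?_, ?_⟩
      · rw [hcu]
        intro h
        exact (s3 v hvch).2 (h ▸ (hP1 hur).1)
      · have hcol : R.col c' (R.par u) = Cp := by
          rw [hCp hur]
          apply R.col_congr
          · intro w hw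
            have hw' := (R.mem_ch _ _).mp hw
            exact hcold w hw'.1 (hw'.2 ▸ hpW)
          · intro hpp
            exact hcold _ hpp (hW _ hpW hpp)
        rw [hcol]
        by_cases hvB : v ∈ B
        · left
          simp only [O', if_pos hvch, if_pos hvB]
          exact Finset.mem_insert_self _ _
        · right
          intro h
          exact hvB (Finset.mem_filter.mpr ⟨hvch, h⟩)
      · rw [hOold u hur hpW]
        have : (O u).image c' = (O u).image c := by
          apply Finset.image_congr
          intro w hw
          obtain ⟨e1, -, e2⟩ := v4 w hw
          apply hcold w e1
          rcases e2 with e2 | e2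
          · rw [e2]; exact hpW
          · exact hW _ (e2 ▸ hpW) e1
        rw [this]
        intro h
        exact (s3 v hvch).2 ((hP1 hur).2 h)
    · intro w hw
      have hcase : w ∈ Q v ∨ (w = u ∧ v ∈ B) := by
        simp only [O', if_pos hvch] at hw
        split_ifs at hw with hvB
        · rw [Finset.mem_insert] at hw
          rcases hw with hw | hw
          · exact Or.inr ⟨hw, hvB⟩
          · exact Or.inl hw
        · exact Or.inl hw
      rcases hcase with h | ⟨rfl, hvB⟩
      · have h := t1 v hvch h
        rw [Finset.mem_erase, R.mem_ch] at h
        exact ⟨h.2.1, h.1, Or.inl h.2.2⟩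
      · have hur : w ≠ R.r := by
          intro hur
          have := (Finset.mem_filter.mp hvB).2
          rw [hCp0 hur] at this
          exact absurd this (by simp)
        refine ⟨hur, ?_, Or.inr rfl⟩
        intro h
        have := R.hdep v hv
        rw [hvu, h] at this
        exact absurd this (lt_irrefl _)
    · have hdu : (R.ch u).card ≤ R.deg u := Nat.le_add_right _ _
      simp only [O', if_pos hvch]
      split_ifs with hvB
      · have hur : u ≠ R.r := by
          intro hur
          have := (Finset.mem_filter.mp hvB).2
          rw [hCp0 hur] at this
          exact absurd this (by simp)
        have hdu : R.deg u = (R.ch u).card + 1 := by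
          simp [RTree.deg, hur]
        rw [hdu]
        exact (Finset.card_insert_le _ _).trans (t4 v hvB)
      · exact (t3 v hvch).trans (Nat.div_le_div_right hdu)
  · have key : ∀ x y, x ≠ R.r → y ≠ R.r → R.par x = u → R.par y ∈ insert u W → y ∈ D.nb x →
        c' x ≠ c' y := by
      intro x y hx hy hxu hyW hxy
      apply s5 x ((R.mem_ch _ _).mpr ⟨hx, hxu⟩) y hxy
      rw [← hZZ]
      simp only [Finset.mem_filter, Finset.mem_univ, true_and]
      exact ⟨hy, hyW⟩
    intro x y hx hy hxW hyW hxy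
    rcases Finset.mem_insert.mp hxW with hxu | hxW'
    · exact key x y hx hy hxu hyW hxy
    rcases Finset.mem_insert.mp hyW with hyu | hyW'
    · exact (key y x hy hx hyu hxW (D.sym _ _ hxy)).symm
    · rw [hcold x hx hxW', hcold y hy hyW']
      exact hN x y hx hy hxW' hyW' hxy
  · rw [hZZ]; exact s2

lemma tree_result {V : Type*} [Fintype V] (R : RTree V) (D : CoreData V) (pb : V → ℕ)
    (hK : ∀ u, D.K u ⊆ (R.ch u).filter (fun x => R.ch x = ∅))
    (hnb : ∀ x, R.ch x ≠ ∅ → D.nb x = ∅)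
    (hnum : ∀ u, (D.K u = ∅ ∧ ((R.ch u).filter (fun x => R.ch x = ∅)).card + 2 + pb u ≤ D.k) ∨
      (((R.ch u).filter (fun x => R.ch x = ∅)).card + 3 + pb u ≤ D.k + (D.K u).card))
    (hs : ∀ u, (R.ch u).card + pb u ≤ D.k)
    (hp1 : ∀ u, u ≠ R.r → 1 + R.deg (R.par u) / 2 ≤ pb u)
    (hp2 : ∀ u, u ≠ R.r → R.deg (R.par u) ≤ pb u + ((R.ch u).card + 1) / 2) :
    ∃ (c : V → ℕ) (O : V → Finset V), (∀ v, v ≠ R.r → VOK R D.L c O v) ∧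
      (∀ x y, x ≠ R.r → y ≠ R.r → y ∈ D.nb x → c x ≠ c y) := by
  have main : ∀ n, n ≤ Fintype.card V → ∃ W : Finset V, W.card = n ∧
      (∀ w ∈ W, w ≠ R.r → R.par w ∈ W) ∧ TState R D W := by
    intro n
    induction n with
    | zero =>
      intro _
      refine ⟨∅, rfl, by simp, fun _ => 0, fun _ => ∅, by simp, by simp, ?_⟩
      simp only [Finset.notMem_empty, and_false, Finset.filter_false]
      exact CInv_init D _
    | succ n ih =>
      intro hn
      obtain ⟨W, h1, h2, h3⟩ := ih (by omega)
      have hne : (Finset.univ \ W).Nonempty := by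
        rw [← Finset.card_pos, Finset.card_sdiff_of_subset (Finset.subset_univ _),
          Finset.card_univ]
        omega
      obtain ⟨u, hu, hmin⟩ := Finset.exists_min_image _ R.dep hne
      rw [Finset.mem_sdiff] at hu
      have hup : u ≠ R.r → R.par u ∈ W := by
        intro hur
        by_contra hp
        have := hmin (R.par u) (Finset.mem_sdiff.mpr ⟨Finset.mem_univ _, hp⟩)
        have := R.hdep u hur
        omega
      refine ⟨insert u W, by rw [Finset.card_insert_of_notMem hu.2, h1], ?_,
        tstate_step R D pb hK hnb hnum hs hp1 hp2 W h2 h3 u hu.2 hup⟩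
      intro w hw hwr
      rw [Finset.mem_insert] at hw
      rcases hw with rfl | hw
      · exact Finset.mem_insert_of_mem (hup hwr)
      · exact Finset.mem_insert_of_mem (h2 w hw hwr)
  obtain ⟨W, h1, h2, c, O, h3, h4, -⟩ := main _ le_rfl
  have hWu : W = Finset.univ := by rwa [Finset.card_eq_iff_eq_univ] at h1
  subst hWu
  exact ⟨c, O, fun v hv => h3 v hv (Finset.mem_univ _),
    fun x y hx hy hxy => h4 x y hx hy (Finset.mem_univ _) (Finset.mem_univ _) hxy⟩

lemma exists_rtree {V : Type*} [Fintype V] (T : SimpleGraph V) (hT : T.IsTree) (r : V) :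
    ∃ R : RTree V, R.r = r ∧
      ∀ a b, T.Adj a b ↔ (a ≠ R.r ∧ R.par a = b) ∨ (b ≠ R.r ∧ R.par b = a) := by
  have hex : ∀ v, ∃ p : T.Walk r v, p.IsPath := fun v => hT.connected.exists_isPath r v
  choose P hP using hex
  have huniq : ∀ v (q : T.Walk r v), q.IsPath → q = P v := by
    intro v q hq
    exact congrArg Subtype.val ((hT.isAcyclic.subsingleton_path r v).elim ⟨q, hq⟩ ⟨P v, hP v⟩)
  have hnn : ∀ v, v ≠ r → ¬ (P v).Nil := by
    intro v hv hn
    exact hv hn.eq.symm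
  have hadj : ∀ v, v ≠ r → T.Adj (P v).penultimate v := fun v hv => Walk.adj_penultimate (hnn v hv)
  have hsub : ∀ a b, T.Adj a b → a ∈ (P b).support → b ≠ r ∧ (P b).penultimate = a := by
    intro a b hab ha
    refine ⟨?_, (hT.isAcyclic.eq_penultimate_of_adj_end (hP b) hab.symm ha).symm⟩
    intro hbr
    subst hbr
    have : Walk.nil = P b := huniq b _ Walk.IsPath.nil
    rw [← this] at ha
    simp at ha
    exact hab.ne ha
  refine ⟨⟨r, fun v => (P v).penultimate, fun v => (P v).length, ?_⟩, rfl, ?_⟩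
  · intro v hv
    have h1 := huniq _ (P v).dropLast ((hP v).dropLast)
    have h2 : 0 < (P v).length := by
      have := hnn v hv
      rw [Walk.nil_iff_length_eq] at this
      omega
    show (P (P v).penultimate).length < _
    rw [← h1]
    simp
    omega
  · intro a b
    constructor
    · intro hab
      by_cases ha : a ∈ (P b).support
      · exact Or.inr (hsub a b hab ha)
      · exact Or.inl (hsub b a hab.symm
          (hT.isAcyclic.mem_support_of_ne_mem_support_of_adj_of_isPath (hP a) (hP b) hab ha))
    · rintro (⟨h1, rfl⟩ | ⟨h1, rfl⟩)
      · exact (hadj a h1).symm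
      · exact hadj b h1

lemma rtree_deg {V : Type*} [Fintype V] (T : SimpleGraph V) (R : RTree V)
    (h : ∀ a b, T.Adj a b ↔ (a ≠ R.r ∧ R.par a = b) ∨ (b ≠ R.r ∧ R.par b = a)) (u : V) :
    T.degree u = R.deg u := by
  unfold RTree.deg
  rw [← card_neighborFinset_eq_degree]
  have : T.neighborFinset u = R.ch u ∪ if u = R.r then ∅ else {R.par u} := by
    ext v
    rw [mem_neighborFinset, h, Finset.mem_union, R.mem_ch]
    split_ifs with hu
    · simp [hu]
    · simp only [Finset.mem_singleton]
      constructor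
      · rintro (h1 | h1)
        · exact Or.inr h1.2.symm
        · exact Or.inl h1
      · rintro (h1 | h1)
        · exact Or.inr h1
        · exact Or.inl ⟨hu, h1.symm⟩
  rw [this, Finset.card_union_of_disjoint]
  · split_ifs <;> simp
  · split_ifs with hu
    · simp
    · rw [Finset.disjoint_singleton_right, R.mem_ch]
      rintro ⟨h1, h2⟩
      have := R.hdep u hu
      have := R.hdep _ h1
      rw [h2] at this
      omega

lemma exists_cyc_enum {V : Type*} [Fintype V] (C : SimpleGraph V)
    (h02 : ∀ v, C.degree v = 0 ∨ C.degree v = 2)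
    (hr : ∀ u v, C.degree u = 2 → C.degree v = 2 → C.Reachable u v)
    (hne : ∃ v, C.degree v = 2) :
    ∃ (n : ℕ) (l : ZMod n → V), 3 ≤ n ∧ n = C.edgeFinset.card ∧ Function.Injective l ∧
      (∀ v, C.degree v = 2 ↔ ∃ i, l i = v) ∧
      (∀ i j, C.Adj (l i) (l j) ↔ j = i + 1 ∨ i = j + 1) := by
  obtain ⟨v0, hv0⟩ := hne
  have hcyc : C.IsCycles := by
    intro v hv
    rw [Set.ncard_eq_toFinset_card']
    have h1 : C.degree v ≠ 0 := by
      intro h0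
      obtain ⟨w, hw⟩ := hv
      have : 0 < C.degree v := by
        rw [degree_pos_iff_exists_adj]
        exact ⟨w, hw⟩
      omega
    have := (h02 v).resolve_left h1
    rw [← this]
    rfl
  have hn0 : (C.neighborSet v0).Nonempty := by
    have : 0 < C.degree v0 := by omega
    rw [degree_pos_iff_exists_adj] at this
    obtain ⟨w, hw⟩ := this
    exact ⟨w, hw⟩
  obtain ⟨p, hp, hps⟩ := hcyc.exists_cycle_toSubgraph_verts_eq_connectedComponentSupp
    (c := C.connectedComponentMk v0) rfl hn0
  have hn3 : 3 ≤ p.length := hp.three_le_length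
  haveI : NeZero p.length := ⟨by omega⟩
  have hval1 : (1 : ZMod p.length).val = 1 := ZMod.val_one'' (by omega)
  have hsucc : ∀ i : ZMod p.length, p.getVert (i + 1).val = p.getVert (i.val + 1) := by
    intro i
    have hi := ZMod.val_lt i
    rw [ZMod.val_add, hval1]
    by_cases h : i.val + 1 < p.length
    · rw [Nat.mod_eq_of_lt h]
    · have : i.val + 1 = p.length := by omega
      rw [this]
      simp
  have hadj : ∀ i : ZMod p.length, C.Adj (p.getVert i.val) (p.getVert (i + 1).val) := by
    intro i
    rw [hsucc]
    exact p.adj_getVert_succ (ZMod.val_lt i)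
  have hinj : Function.Injective (fun i : ZMod p.length => p.getVert i.val) := by
    intro i j hij
    have hi := ZMod.val_lt i
    have hj := ZMod.val_lt j
    apply ZMod.val_injective
    exact hp.getVert_injOn' (show i.val ≤ p.length - 1 by omega)
      (show j.val ≤ p.length - 1 by omega) hij
  have hdeg : ∀ i : ZMod p.length, C.degree (p.getVert i.val) = 2 := by
    intro i
    refine (h02 _).resolve_left ?_
    have : 0 < C.degree (p.getVert i.val) := by
      rw [degree_pos_iff_exists_adj]
      exact ⟨_, hadj i⟩
    omega
  have hrange : ∀ v, C.degree v = 2 ↔ ∃ i : ZMod p.length, p.getVert i.val = v := by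
    intro v
    constructor
    · intro hv
      have h1 : v ∈ p.toSubgraph.verts := by
        rw [hps]
        exact ConnectedComponent.sound (hr v v0 hv hv0)
      rw [Walk.mem_verts_toSubgraph, Walk.mem_support_iff_exists_getVert] at h1
      obtain ⟨m, hm, hml⟩ := h1
      by_cases h : m < p.length
      · refine ⟨(m : ZMod p.length), ?_⟩
        rw [ZMod.val_cast_of_lt h, hm]
      · refine ⟨0, ?_⟩
        have : m = p.length := by omega
        rw [← hm, this]
        simp
    · rintro ⟨i, rfl⟩
      exact hdeg i
  refine ⟨p.length, fun i => p.getVert i.val, hn3, ?_, hinj, hrange, ?_⟩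
  · have hsum := C.sum_degrees_eq_twice_card_edges
    have h1 : ∑ v, C.degree v = ∑ v ∈ Finset.univ.filter (fun v => C.degree v = 2), 2 := by
      rw [Finset.sum_filter]
      apply Finset.sum_congr rfl
      intro v _
      rcases h02 v with h | h <;> simp [h]
    have h2 : Finset.univ.filter (fun v => C.degree v = 2) =
        Finset.univ.image (fun i : ZMod p.length => p.getVert i.val) := by
      ext v
      simp [hrange]
    rw [h1, h2, Finset.sum_const, Finset.card_image_of_injective _ hinj, Finset.card_univ,
      ZMod.card, smul_eq_mul] at hsum
    omega
  · intro i j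
    have h2ne : (2 : ZMod p.length) ≠ 0 := by
      intro h
      have : ((2 : ℕ) : ZMod p.length) = 0 := by exact_mod_cast h
      rw [ZMod.natCast_eq_zero_iff] at this
      have := Nat.le_of_dvd (by norm_num) this
      omega
    have hN : C.neighborFinset (p.getVert i.val) =
        {p.getVert (i + 1).val, p.getVert (i - 1).val} := by
      symm
      apply Finset.eq_of_subset_of_card_le
      · intro x hx
        rw [mem_neighborFinset]
        rcases Finset.mem_insert.mp hx with rfl | hx
        · exact hadj i
        · rw [Finset.mem_singleton.mp hx]
          have := (hadj (i - 1)).symm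
          rwa [sub_add_cancel] at this
      · rw [card_neighborFinset_eq_degree, hdeg, Finset.card_pair]
        intro h
        have h3 : i + 1 = i - 1 := hinj h
        apply h2ne
        linear_combination h3
    rw [← mem_neighborFinset, hN, Finset.mem_insert, Finset.mem_singleton]
    constructor
    · rintro (h | h)
      · exact Or.inl (hinj h)
      · right
        have h3 : j = i - 1 := hinj h
        rw [h3]; ring
    · rintro (rfl | rfl)
      · exact Or.inl rfl
      · right
        rw [add_sub_cancel_right]

lemma zmod_small_ne (n k : ℕ) (h0 : 0 < k) (h : k < n) : (k : ZMod n) ≠ 0 := by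
  intro h1
  rw [ZMod.natCast_eq_zero_iff] at h1
  have := Nat.le_of_dvd h0 h1
  omega

lemma colour_tree {V : Type*} [Fintype V] (R : RTree V) (n : ℕ) (hn : 3 ≤ n) (l : ZMod n → V)
    (hinj : Function.Injective l)
    (hrange : ∀ v, (v ≠ R.r ∧ R.ch v = ∅) ↔ ∃ i, l i = v)
    (k Δ : ℕ) (L : V → Finset ℕ) (hL : ∀ v, k ≤ (L v).card)
    (hΔ : ∀ v, R.deg v ≤ Δ) (hk1 : 2 * (Δ / 2) + 7 ≤ k)
    (hk2 : ∀ u, u ≠ R.r → (R.deg u + R.deg (R.par u) + Δ) / 2 ≤ k) :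
    ∃ (c : V → ℕ) (O : V → Finset V), (∀ v, v ≠ R.r → VOK R L c O v) ∧
      ∀ i, c (l i) ≠ c (l (i + 1)) := by
  have : NeZero n := ⟨by omega⟩
  have h1 : (1 : ZMod n) ≠ 0 := by exact_mod_cast zmod_small_ne n 1 (by omega) (by omega)
  set nb : V → Finset V := fun x => Finset.univ.filter
    (fun y => ∃ i, (x = l i ∧ y = l (i + 1)) ∨ (y = l i ∧ x = l (i + 1))) with hnbdef
  have mem_nb : ∀ x y, y ∈ nb x ↔ ∃ i, (x = l i ∧ y = l (i + 1)) ∨ (y = l i ∧ x = l (i + 1)) := by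
    intro x y; simp [hnbdef]
  have nb_l : ∀ i y, y ∈ nb (l i) → y = l (i + 1) ∨ y = l (i - 1) := by
    intro i y hy
    rw [mem_nb] at hy
    obtain ⟨j, ⟨h2, h3⟩ | ⟨h2, h3⟩⟩ := hy
    · rw [hinj h2]; exact Or.inl h3
    · rw [hinj h3, add_sub_cancel_right]; exact Or.inr h2
  have nb_ex : ∀ x y, y ∈ nb x → ∃ i, x = l i := by
    intro x y hy
    rw [mem_nb] at hy
    obtain ⟨j, ⟨h2, h3⟩ | ⟨h2, h3⟩⟩ := hy
    · exact ⟨_, h2⟩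
    · exact ⟨_, h3⟩
  set m : V → ℕ := fun u => ((R.ch u).filter (fun x => R.ch x = ∅)).card with hm
  set pb : V → ℕ := fun u => if u = R.r then 0 else
    max (1 + R.deg (R.par u) / 2) (R.deg (R.par u) - ((R.ch u).card + 1) / 2) with hpb
  have hpbr : ∀ u, u = R.r → pb u = 0 := by intro u hu; simp [hpb, hu]
  have hpbn : ∀ u, u ≠ R.r → pb u =
    max (1 + R.deg (R.par u) / 2) (R.deg (R.par u) - ((R.ch u).card + 1) / 2) := by
    intro u hu; simp [hpb, hu]
  have hms : ∀ u, m u ≤ (R.ch u).card := fun u => Finset.card_filter_le _ _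
  have hdegr : ∀ u, u = R.r → R.deg u = (R.ch u).card := by
    intro u hu; simp [RTree.deg, hu]
  have hdegn : ∀ u, u ≠ R.r → R.deg u = (R.ch u).card + 1 := by
    intro u hu; simp [RTree.deg, hu]
  have hs : ∀ u, (R.ch u).card + pb u ≤ k := by
    intro u
    have h3 := hΔ u
    by_cases hu : u = R.r
    · rw [hpbr u hu]
      rw [hdegr u hu] at h3
      omega
    · have h4 := hk2 u hu
      have h5 := hΔ (R.par u)
      rw [hdegn u hu] at h3 h4
      rw [hpbn u hu]
      omega
  have hbig : ∀ u, 6 + ((R.ch u).card + 1) / 2 + pb u ≤ k := by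
    intro u
    have h3 := hΔ u
    by_cases hu : u = R.r
    · rw [hpbr u hu]
      rw [hdegr u hu] at h3
      omega
    · have h4 := hk2 u hu
      have h5 := hΔ (R.par u)
      rw [hdegn u hu] at h3 h4
      rw [hpbn u hu]
      omega
  set cu : V → ℕ := fun u => if m u + 2 + pb u ≤ k then 0 else
    if m u + 1 + pb u ≤ k then 2 else 3 with hcu
  have hcu1 : ∀ u, cu u ≤ m u / 2 / 2 := by
    intro u
    have h3 := hs u
    have h4 := hbig u
    have h5 := hms u
    simp only [hcu]
    split_ifs <;> omega
  have hcu2 : ∀ u, 0 < cu u → 10 ≤ m u := by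
    intro u
    have h3 := hs u
    have h4 := hbig u
    have h5 := hms u
    simp only [hcu]
    split_ifs <;> omega
  have hcu3 : ∀ u, cu u ≤ 3 := by
    intro u
    simp only [hcu]
    split_ifs <;> omega
  have hcu4 : ∀ u, (cu u = 0 ∧ m u + 2 + pb u ≤ k) ∨ m u + 3 + pb u ≤ k + cu u := by
    intro u
    have h3 := hs u
    have h5 := hms u
    simp only [hcu]
    split_ifs <;> omega
  obtain ⟨X, hX1, hX2, hX3, hX4⟩ := indep_sel (fun i : ℕ => R.par (l (i : ZMod n))) n
  have hmcard : ∀ u, ((Finset.range n).filter (fun i : ℕ => R.par (l (i : ZMod n)) = u)).card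
      = m u := by
    intro u
    apply Finset.card_bij (fun (i : ℕ) _ => l (i : ZMod n))
    · intro i hi
      rw [Finset.mem_filter] at hi ⊢
      have := (hrange (l (i : ZMod n))).mpr ⟨_, rfl⟩
      exact ⟨(R.mem_ch _ _).mpr ⟨this.1, hi.2⟩, this.2⟩
    · intro i hi j hj hij
      have := hinj hij
      rw [Finset.mem_filter, Finset.mem_range] at hi hj
      have h2 := congrArg ZMod.val this
      rwa [ZMod.val_cast_of_lt hi.1, ZMod.val_cast_of_lt hj.1] at h2
    · intro v hv
      rw [Finset.mem_filter, R.mem_ch] at hv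
      obtain ⟨i, rfl⟩ := (hrange v).mp ⟨hv.1.1, hv.2⟩
      refine ⟨i.val, ?_, ?_⟩
      · rw [Finset.mem_filter, Finset.mem_range, ZMod.natCast_zmod_val]
        exact ⟨ZMod.val_lt i, hv.1.2⟩
      · rw [ZMod.natCast_zmod_val]
  have hn10 : ∀ u, 0 < cu u → 10 ≤ n := by
    intro u hu
    have h3 := hcu2 u hu
    rw [← hmcard u] at h3
    have h4 := Finset.card_filter_le (Finset.range n) (fun i : ℕ => R.par (l (i : ZMod n)) = u)
    rw [Finset.card_range] at h4
    omega
  have hY : ∀ u, ∃ Y ⊆ X.filter (fun i : ℕ => R.par (l (i : ZMod n)) = u), Y.card = cu u := by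
    intro u
    apply Finset.exists_subset_card_eq
    refine (hcu1 u).trans ?_
    rw [← hmcard u]
    exact hX4 u
  choose Y hYs hYc using hY
  set K : V → Finset V := fun u => (Y u).image (fun i : ℕ => l (i : ZMod n)) with hKdef
  have memK : ∀ u x, x ∈ K u → ∃ i ∈ X, i ∈ Y u ∧ i < n ∧ R.par x = u ∧ l (i : ZMod n) = x := by
    intro u x hx
    simp only [hKdef, Finset.mem_image] at hx
    obtain ⟨i, hi, rfl⟩ := hx
    have := Finset.mem_filter.mp (hYs u hi)
    exact ⟨i, this.1, hi, Finset.mem_range.mp (hX1 this.1), this.2, rfl⟩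
  have hKc : ∀ u, (K u).card = cu u := by
    intro u
    rw [← hYc u]
    apply Finset.card_image_of_injOn
    intro i hi j hj hij
    have := hinj hij
    have hi' := Finset.mem_range.mp (hX1 (Finset.mem_filter.mp (hYs u hi)).1)
    have hj' := Finset.mem_range.mp (hX1 (Finset.mem_filter.mp (hYs u hj)).1)
    have h2 := congrArg ZMod.val this
    rwa [ZMod.val_cast_of_lt hi', ZMod.val_cast_of_lt hj'] at h2
  have hXsucc : ∀ i ∈ X, ∀ j ∈ X, (j : ZMod n) ≠ (i : ZMod n) + 1 := by
    intro i hi j hj hij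
    have hi' := Finset.mem_range.mp (hX1 hi)
    have hj' := Finset.mem_range.mp (hX1 hj)
    have h2 : ((j : ℕ) : ZMod n) = ((i + 1 : ℕ) : ZMod n) := by push_cast; exact hij
    have h3 := congrArg ZMod.val h2
    rw [ZMod.val_cast_of_lt hj', ZMod.val_natCast] at h3
    by_cases h : i + 1 < n
    · rw [Nat.mod_eq_of_lt h] at h3
      subst h3
      exact hX3 i hi hj
    · have : i + 1 = n := by omega
      rw [this, Nat.mod_self] at h3
      subst h3
      exact hX2 hj
  let D : CoreData V :=
    { nb := nb
      K := K
      L := L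
      k := k
      sym := by
        intro x y h
        rw [mem_nb] at h ⊢
        obtain ⟨i, h⟩ := h
        exact ⟨i, h.symm⟩
      irr := by
        intro x h
        rw [mem_nb] at h
        obtain ⟨i, h⟩ := h
        have : l i = l (i + 1) := by
          rcases h with h | h
          · exact h.1.symm.trans h.2
          · exact h.1.symm.trans h.2
        have := hinj this
        apply h1
        linear_combination -this
      nb2 := by
        intro x
        by_cases hx : ∃ i, x = l i
        · obtain ⟨i, rfl⟩ := hx
          refine (Finset.card_le_card (t := {l (i + 1), l (i - 1)}) ?_).trans Finset.card_le_two
          intro y hy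
          rw [Finset.mem_insert, Finset.mem_singleton]
          exact nb_l i y hy
        · have : nb x = ∅ := by
            rw [Finset.eq_empty_iff_forall_notMem]
            intro y hy
            exact hx (nb_ex x y hy)
          rw [this]; simp
      K3 := by
        intro u
        rw [hKc]; exact hcu3 u
      Kdisj := by
        intro g h x hg hh
        obtain ⟨_, _, _, _, h3, _⟩ := memK g x hg
        obtain ⟨_, _, _, _, h4, _⟩ := memK h x hh
        exact h3.symm.trans h4
      Kind := by
        intro g h x y hx hy hxy
        obtain ⟨i, hi, _, _, _, rfl⟩ := memK g x hx
        obtain ⟨j, hj, _, _, _, rfl⟩ := memK h y hy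
        rcases nb_l _ _ hxy with h5 | h5
        · exact hXsucc i hi j hj (hinj h5)
        · apply hXsucc j hj i hi
          rw [hinj h5]; ring
      hcom := by
        intro g x hx y hy hxy z z' hz hz' hzz hzz'
        have hg : 0 < cu g := by
          rw [← hKc]; exact Finset.card_pos.mpr ⟨x, hx⟩
        have h10 := hn10 g hg
        have h4 : (4 : ZMod n) ≠ 0 := by
          exact_mod_cast zmod_small_ne n 4 (by omega) (by omega)
        obtain ⟨i, _, _, _, _, rfl⟩ := memK g x hx
        obtain ⟨j, _, _, _, _, rfl⟩ := memK g y hy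
        have key : ∀ a b : ZMod n, a = b → l a = l b := fun a b h => by rw [h]
        rcases nb_l _ _ hz with rfl | rfl <;> rcases nb_l _ _ hzz with rfl | rfl <;>
          first
          | rfl
          | skip
        all_goals
          rcases nb_l _ _ hz' with h5 | h5 <;> rcases nb_l _ _ hzz' with h6 | h6
        all_goals
          replace h5 := hinj h5
          replace h6 := hinj h6
          first
          | (exfalso; exact hxy (key _ _ (by linear_combination h5)))
          | (exfalso; exact hxy (key _ _ (by linear_combination h6)))
          | (exfalso; apply h4; linear_combination h5 + h6)
          | (exfalso; apply h4; linear_combination -h5 - h6)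
          | (exfalso; apply h4; linear_combination h5 - h6)
          | (exfalso; apply h4; linear_combination h6 - h5)
      hL := hL }
  obtain ⟨c, O, hc1, hc2⟩ := tree_result R D pb
    (by
      intro u x hx
      obtain ⟨i, _, _, _, h3, rfl⟩ := memK u x hx
      have := (hrange (l (i : ZMod n))).mpr ⟨_, rfl⟩
      exact Finset.mem_filter.mpr ⟨(R.mem_ch _ _).mpr ⟨this.1, h3⟩, this.2⟩)
    (by
      intro x hx
      show nb x = ∅
      rw [Finset.eq_empty_iff_forall_notMem]
      intro y hy
      obtain ⟨i, rfl⟩ := nb_ex x y hy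
      exact hx ((hrange _).mpr ⟨i, rfl⟩).2)
    (by
      intro u
      rcases hcu4 u with h | h
      · left
        refine ⟨?_, h.2⟩
        show K u = ∅
        rw [← Finset.card_eq_zero, hKc]
        exact h.1
      · right
        show m u + 3 + pb u ≤ k + (K u).card
        rw [hKc]
        exact h)
    hs
    (by
      intro u hu
      rw [hpbn u hu]
      exact le_max_left _ _)
    (by
      intro u hu
      rw [hpbn u hu]
      omega)
  refine ⟨c, O, hc1, fun i => ?_⟩
  apply hc2 _ _ ((hrange _).mpr ⟨_, rfl⟩).1 ((hrange _).mpr ⟨_, rfl⟩).1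
  show l (i + 1) ∈ nb (l i)
  rw [mem_nb]
  exact ⟨i, Or.inl ⟨rfl, rfl⟩⟩

lemma alt_two (a b c d c₁ c₂ : ℕ) (h1 : a = c₁ ∨ a = c₂) (h2 : b = c₁ ∨ b = c₂)
    (h3 : c = c₁ ∨ c = c₂) (h4 : d = c₁ ∨ d = c₂) (hab : a ≠ b) (hbc : b ≠ c) (hcd : c ≠ d) :
    a = c ∧ b = d := by
  omega

lemma star_of_local {V : Type*} (G : SimpleGraph V) (φ : Sym2 V → ℕ)
    (hp : ∀ b a d, G.Adj b a → G.Adj b d → a ≠ d → φ s(b, a) ≠ φ s(b, d))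
    (h4 : ∀ b a d x y, G.Adj b a → G.Adj b d → G.Adj a x → G.Adj d y → a ≠ d → x ≠ b → y ≠ b →
      ¬ (φ s(a, x) = φ s(b, d) ∧ φ s(b, a) = φ s(d, y))) :
    IsStarEdgeColoring G φ := by
  have main : ∀ v0 v1 v2 v3 v4, G.Adj v0 v1 → G.Adj v1 v2 → G.Adj v2 v3 → G.Adj v3 v4 →
      v0 ≠ v2 → v1 ≠ v3 → v2 ≠ v4 → ∀ c₁ c₂,
      (φ s(v0, v1) = c₁ ∨ φ s(v0, v1) = c₂) → (φ s(v1, v2) = c₁ ∨ φ s(v1, v2) = c₂) →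
      (φ s(v2, v3) = c₁ ∨ φ s(v2, v3) = c₂) → (φ s(v3, v4) = c₁ ∨ φ s(v3, v4) = c₂) → False := by
    intro v0 v1 v2 v3 v4 a1 a2 a3 a4 n1 n2 n3 c₁ c₂ e1 e2 e3 e4
    have p1 := hp v1 v0 v2 a1.symm a2 n1
    have p2 := hp v2 v1 v3 a2.symm a3 n2
    have p3 := hp v3 v2 v4 a3.symm a4 n3
    have q := h4 v2 v1 v3 v0 v4 a2.symm a3 a1.symm a4 n2 n1 n3.symm
    rw [Sym2.eq_swap (a := v0)] at e1
    rw [Sym2.eq_swap (a := v3) (b := v2)] at p3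
    rw [Sym2.eq_swap (a := v2) (b := v1)] at p2 q
    exact q (alt_two _ _ _ _ c₁ c₂ e1 e2 e3 e4 p1 p2 p3)
  have main2 : ∀ u v (p : G.Walk u v), p.length = 4 → u ≠ p.getVert 2 →
      p.getVert 1 ≠ p.getVert 3 → p.getVert 2 ≠ v → ∀ c₁ c₂,
      (∀ e ∈ p.edges, φ e = c₁ ∨ φ e = c₂) → False := by
    intro u v p hl n1 n2 n3 c₁ c₂ hc
    rcases p with _ | ⟨a1, p⟩
    · simp at hl
    rcases p with _ | ⟨a2, p⟩
    · simp at hl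
    rcases p with _ | ⟨a3, p⟩
    · simp at hl
    rcases p with _ | ⟨a4, p⟩
    · simp at hl
    rcases p with _ | ⟨a5, p⟩
    · simp only [Walk.edges_cons, Walk.edges_nil, List.mem_cons, List.not_mem_nil, or_false,
        forall_eq_or_imp, forall_eq] at hc
      exact main _ _ _ _ _ a1 a2 a3 a4 (by simpa using n1) (by simpa using n2)
        (by simpa using n3) c₁ c₂ hc.1 hc.2.1 hc.2.2.1 hc.2.2.2
    · simp at hl
  refine ⟨?_, ?_, ?_⟩
  · rintro e₁ he₁ e₂ he₂ ⟨hne, v, hv1, hv2⟩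
    obtain ⟨a, rfl⟩ := hv1
    obtain ⟨b, rfl⟩ := hv2
    exact hp v a b he₁ he₂ (fun h => hne (by rw [h]))
  · rintro u v p hpath hl ⟨c₁, c₂, hc⟩
    have hi := hpath.getVert_injOn
    refine main2 u v p hl ?_ ?_ ?_ c₁ c₂ hc
    · intro h
      have := hi (x₁ := 0) (x₂ := 2) (by simp) (by simp [hl]) (by simpa using h)
      omega
    · intro h
      have := hi (x₁ := 1) (x₂ := 3) (by simp [hl]) (by simp [hl]) h
      omega
    · intro h
      have := hi (x₁ := 2) (x₂ := 4) (by simp [hl]) (by simp [hl]) (by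
        rw [h, show 4 = p.length from hl.symm]; simp)
      omega
  · rintro u p hpath hl ⟨c₁, c₂, hc⟩
    have hi := hpath.getVert_injOn
    have h4u : p.getVert 4 = u := by rw [← hl]; simp
    refine main2 u u p hl ?_ ?_ ?_ c₁ c₂ hc
    · intro h
      have := hi (x₁ := 4) (x₂ := 2) (by simp [hl]) (by simp [hl]) (by rw [h4u, ← h])
      omega
    · intro h
      have := hi (x₁ := 1) (x₂ := 3) (by simp [hl]) (by simp [hl]) h
      omega
    · intro h
      have := hi (x₁ := 2) (x₂ := 4) (by simp [hl]) (by simp [hl]) (by rw [h4u, h])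
      omega

lemma local_check {V : Type*} [Fintype V] (R : RTree V) (n : ℕ) (l : ZMod n → V)
    (hinj : Function.Injective l)
    (hrange : ∀ v, (v ≠ R.r ∧ R.ch v = ∅) ↔ ∃ i, l i = v)
    (L : V → Finset ℕ) (c : V → ℕ) (O : V → Finset V) (f : ZMod n → ℕ)
    (hV : ∀ v, v ≠ R.r → VOK R L c O v) (hc : ∀ i, c (l i) ≠ c (l (i + 1)))
    (hf1 : ∀ i, f i ≠ f (i + 1)) (hf2 : ∀ i, ¬(f i = f (i + 2) ∧ f (i + 1) = f (i + 3)))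
    (hB : ∀ i, f i ≠ c (l (i - 1)) ∧ f i ≠ c (l i) ∧ f i ≠ c (l (i + 1)) ∧ f i ≠ c (l (i + 2)) ∧
      f i ∉ (O (l i)).image c ∧ f i ∉ (O (l (i + 1))).image c)
    (G : SimpleGraph V) (φ : Sym2 V → ℕ)
    (hG : ∀ b a, G.Adj b a → (a ≠ R.r ∧ R.par a = b ∧ φ s(b, a) = c a) ∨
      (b ≠ R.r ∧ R.par b = a ∧ φ s(b, a) = c b) ∨
      (∃ i, b = l i ∧ a = l (i + 1) ∧ φ s(b, a) = f i) ∨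
      (∃ i, b = l (i + 1) ∧ a = l i ∧ φ s(b, a) = f i)) :
    IsStarEdgeColoring G φ := by
  have hlr : ∀ i, l i ≠ R.r := fun i => ((hrange _).mpr ⟨i, rfl⟩).1
  have hlc : ∀ i v, v ≠ R.r → R.par v ≠ l i := by
    intro i v hv h
    have h1 := ((hrange _).mpr ⟨i, rfl⟩).2
    have : v ∈ R.ch (l i) := (R.mem_ch _ _).mpr ⟨hv, h⟩
    rw [h1] at this
    simp at this
  have hne1 : ∀ b a, b ≠ R.r → G.Adj b a → a ≠ R.par b → φ s(b, a) ∉ (O b).image c := by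
    intro b a hb hba hap
    rcases hG b a hba with ⟨h1, rfl, h3⟩ | ⟨h1, h2, h3⟩ | ⟨i, rfl, rfl, h3⟩ | ⟨i, rfl, rfl, h3⟩
    · rw [h3]
      exact ((hV a h1).2.2.1 hb).2.2
    · exact absurd h2.symm hap
    · rw [h3]; exact (hB i).2.2.2.2.1
    · rw [h3]; exact (hB i).2.2.2.2.2
  -- parent and cycle edge
  have pcp : ∀ i a, G.Adj (l i) a → a ≠ R.par (l i) → φ s(l i, a) ≠ c (l i) := by
    intro i a hia hap
    rcases hG _ a hia with ⟨h1, h2, h3⟩ | ⟨h1, h2, h3⟩ | ⟨j, h1, rfl, h3⟩ | ⟨j, h1, rfl, h3⟩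
    · exact absurd h2 (hlc i a h1)
    · exact absurd h2.symm hap
    · have := hinj h1
      subst this
      rw [h3]; exact (hB i).2.1
    · have := hinj h1
      subst this
      rw [h3]; exact (hB j).2.2.1
  have hpar : ∀ b a, b ≠ R.r → G.Adj b a → R.par b = a → φ s(b, a) = c b := by
    intro b a hb hba hap
    rcases hG b a hba with ⟨h1, h2, h3⟩ | ⟨h1, h2, h3⟩ | ⟨i, h1, h2, h3⟩ | ⟨i, h1, h2, h3⟩
    · exfalso
      have := R.hdep a h1
      have h5 := R.hdep b hb
      rw [h2] at this
      rw [hap] at h5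
      omega
    · exact h3
    · exact absurd (hap.trans h2) (hlc _ _ hb)
    · exact absurd (hap.trans h2) (hlc _ _ hb)
  have half_p : ∀ b a d, G.Adj b a → G.Adj b d → a ≠ d → b ≠ R.r → R.par b = a →
      φ s(b, a) ≠ φ s(b, d) := by
    intro b a d hba hbd had hb hp
    rw [hpar b a hb hba hp]
    rcases hG b d hbd with ⟨h1, rfl, h3⟩ | ⟨h1, h2, h3⟩ | ⟨i, rfl, rfl, h3⟩ | ⟨i, rfl, rfl, h3⟩
    · rw [h3]
      exact (((hV d h1).2.2.1 hb).1).symm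
    · exact absurd (hp.symm.trans h2) had
    · exact (pcp _ _ hbd (by rw [hp]; exact had.symm)).symm
    · exact (pcp _ _ hbd (by rw [hp]; exact had.symm)).symm
  -- two tree edges or tree and cycle edge at the centre
  have key1 : ∀ b a d x y, G.Adj b a → G.Adj b d → G.Adj a x → G.Adj d y → a ≠ d → x ≠ b → y ≠ b →
      b ≠ R.r → R.par b = a → ¬ (φ s(a, x) = φ s(b, d) ∧ φ s(b, a) = φ s(d, y)) := by
    rintro b a d x y hba hbd hax hdy had hxb hyb hb hp ⟨e1, e2⟩
    rw [hpar b a hb hba hp] at e2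
    rcases hG b d hbd with ⟨h1, h2, h3⟩ | ⟨h1, h2, h3⟩ | ⟨i, h1, h2, h3⟩ | ⟨i, h1, h2, h3⟩
    · -- d child of b
      subst h2
      rcases ((hV d h1).2.2.1 hb).2.1 with h4 | h4
      · apply hne1 d y h1 hdy hyb
        rw [← e2]
        exact Finset.mem_image_of_mem c h4
      · apply h4
        rw [hp, ← h3, ← e1]
        rcases hG a x hax with ⟨g1, g2, g3⟩ | ⟨g1, g2, g3⟩ | ⟨j, g1, g2, g3⟩ | ⟨j, g1, g2, g3⟩
        · rw [g3]
          exact Finset.mem_union_left _ (Finset.mem_image_of_mem c ((R.mem_ch _ _).mpr ⟨g1, g2⟩))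
        · rw [g3]
          apply Finset.mem_union_right
          rw [if_neg g1]
          simp
        · exact absurd (hp.trans g1) (hlc _ _ hb)
        · exact absurd (hp.trans g1) (hlc _ _ hb)
    · exact had (hp.symm.trans h2)
    · subst h1 h2
      rcases hG _ y hdy with ⟨g1, g2, g3⟩ | ⟨g1, g2, g3⟩ | ⟨j, g1, g2, g3⟩ | ⟨j, g1, g2, g3⟩
      · exact hlc _ _ g1 g2
      · rw [g3] at e2
        exact hc i e2
      · have := hinj g1
        subst this
        rw [g3] at e2
        apply (hB (i + 1)).1
        rw [← e2, add_sub_cancel_right]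
      · have := add_right_cancel (hinj g1)
        subst this
        exact hyb g2
    · subst h1 h2
      rcases hG _ y hdy with ⟨g1, g2, g3⟩ | ⟨g1, g2, g3⟩ | ⟨j, g1, g2, g3⟩ | ⟨j, g1, g2, g3⟩
      · exact hlc _ _ g1 g2
      · rw [g3] at e2
        exact hc i e2.symm
      · have := hinj g1
        subst this
        exact hyb g2
      · have := hinj g1
        subst this
        rw [g3] at e2
        apply (hB j).2.2.2.1
        rw [← e2]
        congr 2
        ring
  -- two cycle edges at the centre
  have key2 : ∀ i x y, G.Adj (l (i + 1)) x → G.Adj (l (i + 1 + 1 + 1)) y → x ≠ l (i + 1 + 1) →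
      y ≠ l (i + 1 + 1) → ¬ (φ s(l (i + 1), x) = f (i + 1 + 1) ∧
        f (i + 1) = φ s(l (i + 1 + 1 + 1), y)) := by
    rintro i x y hax hdy hxb hyb ⟨e1, e2⟩
    have e1' : f i = f (i + 2) := by
      rcases hG _ x hax with ⟨g1, g2, g3⟩ | ⟨g1, g2, g3⟩ | ⟨j, g1, g2, g3⟩ | ⟨j, g1, g2, g3⟩
      · exact absurd g2 (hlc _ _ g1)
      · exfalso
        apply (hB (i + 1 + 1)).1
        rw [← e1, g3, add_sub_cancel_right]
      · have := hinj g1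
        subst this
        exact absurd g2 hxb
      · have := add_right_cancel (hinj g1)
        subst this
        rw [← g3, e1]
        congr 1
        ring
    have e2' : f (i + 1) = f (i + 3) := by
      rcases hG _ y hdy with ⟨g1, g2, g3⟩ | ⟨g1, g2, g3⟩ | ⟨j, g1, g2, g3⟩ | ⟨j, g1, g2, g3⟩
      · exact absurd g2 (hlc _ _ g1)
      · exfalso
        apply (hB (i + 1)).2.2.2.1
        rw [e2, g3]
        congr 2
        ring
      · have := hinj g1
        subst this
        rw [e2, g3]
        congr 1
        ring
      · have := add_right_cancel (hinj g1)
        subst this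
        exact absurd g2 hyb
    exact hf2 i ⟨e1', e2'⟩
  have key2' : ∀ i b a d x y, G.Adj b a → G.Adj b d → G.Adj a x → G.Adj d y → x ≠ b → y ≠ b →
      b = l (i + 1) → a = l i → φ s(b, a) = f i → d = l (i + 1 + 1) → φ s(b, d) = f (i + 1) →
      ¬ (φ s(a, x) = φ s(b, d) ∧ φ s(b, a) = φ s(d, y)) := by
    rintro i b a d x y hba hbd hax hdy hxb hyb rfl rfl h1 rfl h2 ⟨e1, e2⟩
    obtain ⟨j, rfl⟩ : ∃ j, i = j + 1 := ⟨i - 1, by ring⟩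
    rw [h2] at e1
    rw [h1] at e2
    exact key2 j x y hax hdy hxb hyb ⟨e1, e2⟩
  apply star_of_local
  · intro b a d hba hbd had
    by_cases hpa : b ≠ R.r ∧ R.par b = a
    · exact half_p b a d hba hbd had hpa.1 hpa.2
    by_cases hpd : b ≠ R.r ∧ R.par b = d
    · exact (half_p b d a hbd hba had.symm hpd.1 hpd.2).symm
    rcases hG b a hba with ⟨h1, h2, h3⟩ | ⟨h1, h2, h3⟩ | ⟨i, h1, h2, h3⟩ | ⟨i, h1, h2, h3⟩
    · rcases hG b d hbd with ⟨g1, g2, g3⟩ | ⟨g1, g2, g3⟩ | ⟨j, g1, g2, g3⟩ | ⟨j, g1, g2, g3⟩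
      · rw [h3, g3]
        exact ((hV a h1).2.1 d ((R.mem_ch _ _).mpr ⟨g1, g2.trans h2.symm⟩) had.symm).1
      · exact absurd ⟨g1, g2⟩ hpd
      · exact absurd (h2.trans g1) (hlc _ _ h1)
      · exact absurd (h2.trans g1) (hlc _ _ h1)
    · exact absurd ⟨h1, h2⟩ hpa
    · rcases hG b d hbd with ⟨g1, g2, g3⟩ | ⟨g1, g2, g3⟩ | ⟨j, g1, g2, g3⟩ | ⟨j, g1, g2, g3⟩
      · exact absurd (g2.trans h1) (hlc _ _ g1)
      · exact absurd ⟨g1, g2⟩ hpd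
      · have := hinj (h1.symm.trans g1)
        subst this
        exact absurd (h2.trans g2.symm) had
      · have := hinj (h1.symm.trans g1)
        subst this
        rw [h3, g3]
        exact (hf1 j).symm
    · rcases hG b d hbd with ⟨g1, g2, g3⟩ | ⟨g1, g2, g3⟩ | ⟨j, g1, g2, g3⟩ | ⟨j, g1, g2, g3⟩
      · exact absurd (g2.trans h1) (hlc _ _ g1)
      · exact absurd ⟨g1, g2⟩ hpd
      · have := hinj (h1.symm.trans g1)
        subst this
        rw [h3, g3]
        exact hf1 i
      · have := add_right_cancel (hinj (h1.symm.trans g1))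
        subst this
        exact absurd (h2.trans g2.symm) had
  · intro b a d x y hba hbd hax hdy had hxb hyb
    by_cases hpa : b ≠ R.r ∧ R.par b = a
    · exact key1 b a d x y hba hbd hax hdy had hxb hyb hpa.1 hpa.2
    by_cases hpd : b ≠ R.r ∧ R.par b = d
    · rintro ⟨e1, e2⟩
      exact key1 b d a y x hbd hba hdy hax had.symm hyb hxb hpd.1 hpd.2 ⟨e2.symm, e1.symm⟩
    rcases hG b a hba with ⟨h1, h2, h3⟩ | ⟨h1, h2, h3⟩ | ⟨i, h1, h2, h3⟩ | ⟨i, h1, h2, h3⟩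
    · rcases hG b d hbd with ⟨g1, g2, g3⟩ | ⟨g1, g2, g3⟩ | ⟨j, g1, g2, g3⟩ | ⟨j, g1, g2, g3⟩
      · rintro ⟨e1, e2⟩
        rcases ((hV a h1).2.1 d ((R.mem_ch _ _).mpr ⟨g1, g2.trans h2.symm⟩) had.symm).2 with
          h4 | h4
        · apply hne1 a x h1 hax (by rw [h2]; exact hxb)
          rw [e1, g3]
          exact Finset.mem_image_of_mem c h4
        · apply hne1 d y g1 hdy (by rw [g2]; exact hyb)
          rw [← e2, h3]
          exact Finset.mem_image_of_mem c h4
      · exact absurd ⟨g1, g2⟩ hpd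
      · exact absurd (h2.trans g1) (hlc _ _ h1)
      · exact absurd (h2.trans g1) (hlc _ _ h1)
    · exact absurd ⟨h1, h2⟩ hpa
    · rcases hG b d hbd with ⟨g1, g2, g3⟩ | ⟨g1, g2, g3⟩ | ⟨j, g1, g2, g3⟩ | ⟨j, g1, g2, g3⟩
      · exact absurd (g2.trans h1) (hlc _ _ g1)
      · exact absurd ⟨g1, g2⟩ hpd
      · have := hinj (h1.symm.trans g1)
        subst this
        exact absurd (h2.trans g2.symm) had
      · have := hinj (h1.symm.trans g1)
        subst this
        rintro ⟨e1, e2⟩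
        exact key2' j b d a y x hbd hba hdy hax hyb hxb g1 g2 g3 h2 h3 ⟨e2.symm, e1.symm⟩
    · rcases hG b d hbd with ⟨g1, g2, g3⟩ | ⟨g1, g2, g3⟩ | ⟨j, g1, g2, g3⟩ | ⟨j, g1, g2, g3⟩
      · exact absurd (g2.trans h1) (hlc _ _ g1)
      · exact absurd ⟨g1, g2⟩ hpd
      · have := hinj (h1.symm.trans g1)
        subst this
        exact key2' i b a d x y hba hbd hax hdy hxb hyb h1 h2 h3 g2 g3
      · have := add_right_cancel (hinj (h1.symm.trans g1))
        subst this
        exact absurd (h2.trans g2.symm) had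

lemma card_six {U : Type*} (c : U → ℕ) (a b d e : ℕ) (S S' : Finset U) :
    ((({a, b, d, e} : Finset ℕ) ∪ S.image c) ∪ S'.image c).card ≤ 4 + S.card + S'.card := by
  refine (Finset.card_union_le _ _).trans ?_
  apply Nat.add_le_add _ Finset.card_image_le
  refine (Finset.card_union_le _ _).trans ?_
  exact Nat.add_le_add Finset.card_le_four Finset.card_image_le

theorem stmt_7 {V : Type*} [Fintype V] (H T C : SimpleGraph V)
    (hH : IsGenHalin H T C) (hC : C.edgeFinset.card ≠ 5) :
    listStarChromaticIndex H ≤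
      max ((oreDegree T + T.maxDegree) / 2) (2 * (T.maxDegree / 2) + 7) := by
  obtain ⟨hT, hΔ3, rfl, hdisj, hdeg, h02, hreach⟩ := hH
  apply Nat.sInf_le
  set k := max ((oreDegree T + T.maxDegree) / 2) (2 * (T.maxDegree / 2) + 7) with hk
  intro LL hLL
  have hne := hT.connected.nonempty
  obtain ⟨r, hr⟩ := T.exists_maximal_degree_vertex
  obtain ⟨R, hRr, hadj⟩ := exists_rtree T hT r
  have hRdeg := rtree_deg T R hadj
  have hleaf : ∀ v, (v ≠ R.r ∧ R.ch v = ∅) ↔ C.degree v = 2 := by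
    intro v
    rw [← hdeg, hRdeg]
    unfold RTree.deg
    by_cases hv : v = R.r
    · have : (R.ch v).card ≥ 3 := by
        have h1 := hRdeg v
        unfold RTree.deg at h1
        rw [if_pos hv, hv, hRr, ← hr] at h1
        rw [hv, hRr]
        omega
      simp only [hv, ne_eq, not_true_eq_false, false_and, if_true, false_iff]
      rw [hv] at this
      omega
    · simp [hv]
  have hexleaf : ∃ v, C.degree v = 2 := by
    have : Nontrivial V := by
      have h1 : 0 < T.degree r := by omega
      rw [degree_pos_iff_exists_adj] at h1
      obtain ⟨w, hw⟩ := h1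
      exact ⟨r, w, hw.ne⟩
    obtain ⟨v, hv⟩ := hT.exists_vert_degree_one_of_nontrivial
    exact ⟨v, (hdeg v).mp hv⟩
  obtain ⟨n, l, hn3, hncard, hinj, hlr, hCadj⟩ := exists_cyc_enum C h02 hreach hexleaf
  have hn5 : n ≠ 5 := by rw [hncard]; exact hC
  have hrange : ∀ v, (v ≠ R.r ∧ R.ch v = ∅) ↔ ∃ i, l i = v := fun v => (hleaf v).trans (hlr v)
  have hΔ : ∀ v, R.deg v ≤ T.maxDegree := by
    intro v
    rw [← hRdeg]
    exact T.degree_le_maxDegree v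
  have hk1 : 2 * (T.maxDegree / 2) + 7 ≤ k := le_max_right _ _
  have hTpar : ∀ u, u ≠ R.r → T.Adj u (R.par u) := fun u hu => (hadj _ _).mpr (Or.inl ⟨hu, rfl⟩)
  have hk2 : ∀ u, u ≠ R.r → (R.deg u + R.deg (R.par u) + T.maxDegree) / 2 ≤ k := by
    intro u hu
    have h1 : R.deg u + R.deg (R.par u) ≤ oreDegree T := by
      apply le_csSup
      · refine ⟨2 * T.maxDegree, ?_⟩
        rintro _ ⟨x, y, -, rfl⟩
        have := T.degree_le_maxDegree x
        have := T.degree_le_maxDegree y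
        omega
      · exact ⟨u, R.par u, hTpar u hu, by rw [hRdeg, hRdeg]⟩
    refine le_trans ?_ (le_max_left _ _)
    apply Nat.div_le_div_right
    omega
  obtain ⟨c, O, hV, hcl⟩ := colour_tree R n hn3 l hinj hrange k T.maxDegree
    (fun v => if v = R.r then Finset.range k else LL s(v, R.par v))
    (by
      intro v
      split_ifs with hv
      · simp
      · apply hLL
        rw [mem_edgeSet]
        exact Or.inl (hTpar v hv))
    hΔ hk1 hk2
  have hCl : ∀ i, C.Adj (l i) (l (i + 1)) := fun i => (hCadj _ _).mpr (Or.inl rfl)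
  have hO : ∀ i, (O (l i)).card ≤ T.maxDegree / 2 := by
    intro i
    have h1 := (hV (l i) ((hrange _).mpr ⟨i, rfl⟩).1).2.2.2.2
    exact h1.trans (Nat.div_le_div_right (hΔ _))
  obtain ⟨f, hf⟩ := cycle_list n hn3 hn5
    (fun i => LL s(l i, l (i + 1)) \
      ((({c (l (i - 1)), c (l i), c (l (i + 1)), c (l (i + 2))} : Finset ℕ) ∪ (O (l i)).image c) ∪
        (O (l (i + 1))).image c))
    (by
      intro i
      have h1 := card_six c (c (l (i - 1))) (c (l i)) (c (l (i + 1))) (c (l (i + 2))) (O (l i))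
        (O (l (i + 1)))
      have h2 := hO i
      have h3 := hO (i + 1)
      have h4 : k ≤ (LL s(l i, l (i + 1))).card := by
        apply hLL
        rw [mem_edgeSet]
        exact Or.inr (hCl i)
      have h5 := Finset.le_card_sdiff
        ((({c (l (i - 1)), c (l i), c (l (i + 1)), c (l (i + 2))} : Finset ℕ) ∪
          (O (l i)).image c) ∪ (O (l (i + 1))).image c) (LL s(l i, l (i + 1)))
      omega)
  have hB : ∀ i, f i ≠ c (l (i - 1)) ∧ f i ≠ c (l i) ∧ f i ≠ c (l (i + 1)) ∧
      f i ≠ c (l (i + 2)) ∧ f i ∉ (O (l i)).image c ∧ f i ∉ (O (l (i + 1))).image c := by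
    intro i
    have h1 := (Finset.mem_sdiff.mp (hf i).1).2
    rw [Finset.mem_union, Finset.mem_union, not_or, not_or] at h1
    obtain ⟨⟨h2, h3⟩, h4⟩ := h1
    simp only [Finset.mem_insert, Finset.mem_singleton, not_or] at h2
    exact ⟨h2.1, h2.2.1, h2.2.2.1, h2.2.2.2, h3, h4⟩
  let φ : Sym2 V → ℕ := fun e =>
    if h : ∃ v, v ≠ R.r ∧ e = s(v, R.par v) then c h.choose
    else if h : ∃ i, e = s(l i, l (i + 1)) then f h.choose else 0
  have hφT : ∀ v, v ≠ R.r → φ s(v, R.par v) = c v := by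
    intro v hv
    have h : ∃ w, w ≠ R.r ∧ s(v, R.par v) = s(w, R.par w) := ⟨v, hv, rfl⟩
    show (if h : ∃ w, w ≠ R.r ∧ s(v, R.par v) = s(w, R.par w) then c h.choose else _) = _
    rw [dif_pos h]
    obtain ⟨h1, h2⟩ := h.choose_spec
    generalize h.choose = w at h1 h2
    rw [Sym2.eq_iff] at h2
    rcases h2 with h2 | h2
    · rw [h2.1]
    · exfalso
      have h3 := R.hdep v hv
      have h4 := R.hdep w h1
      rw [h2.2] at h3
      rw [← h2.1] at h4
      omega
  have hφC : ∀ i, φ s(l i, l (i + 1)) = f i := by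
    intro i
    have h0 : ¬ ∃ w, w ≠ R.r ∧ s(l i, l (i + 1)) = s(w, R.par w) := by
      rintro ⟨w, hw, he⟩
      have h1 : s(l i, l (i + 1)) ∈ T.edgeSet := by
        rw [he]
        exact hTpar w hw
      exact Set.disjoint_left.mp hdisj h1 (hCl i)
    have h : ∃ j, s(l i, l (i + 1)) = s(l j, l (j + 1)) := ⟨i, rfl⟩
    show (if h : ∃ w, w ≠ R.r ∧ s(l i, l (i + 1)) = s(w, R.par w) then c h.choose
      else if h : ∃ j, s(l i, l (i + 1)) = s(l j, l (j + 1)) then f h.choose else 0) = _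
    rw [dif_neg h0, dif_pos h]
    have h2 := h.choose_spec
    generalize h.choose = j at h2
    rw [Sym2.eq_iff] at h2
    rcases h2 with h2 | h2
    · rw [hinj h2.1]
    · exfalso
      have h3 := hinj h2.1
      have h4 := hinj h2.2
      have : ((2 : ℕ) : ZMod n) = 0 := by
        push_cast
        linear_combination h4 - h3
      exact zmod_small_ne n 2 (by omega) (by omega) this
  have hG : ∀ b a, (T ⊔ C).Adj b a → (a ≠ R.r ∧ R.par a = b ∧ φ s(b, a) = c a) ∨
      (b ≠ R.r ∧ R.par b = a ∧ φ s(b, a) = c b) ∨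
      (∃ i, b = l i ∧ a = l (i + 1) ∧ φ s(b, a) = f i) ∨
      (∃ i, b = l (i + 1) ∧ a = l i ∧ φ s(b, a) = f i) := by
    intro b a hba
    rcases hba with h | h
    · rcases (hadj b a).mp h with ⟨h1, rfl⟩ | ⟨h1, rfl⟩
      · exact Or.inr (Or.inl ⟨h1, rfl, hφT b h1⟩)
      · refine Or.inl ⟨h1, rfl, ?_⟩
        rw [Sym2.eq_swap]
        exact hφT a h1
    · have hd : ∀ x y, C.Adj x y → C.degree x = 2 := by
        intro x y hxy
        refine (h02 x).resolve_left ?_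
        have : 0 < C.degree x := by
          rw [degree_pos_iff_exists_adj]
          exact ⟨y, hxy⟩
        omega
      obtain ⟨i, rfl⟩ := (hlr b).mp (hd b a h)
      obtain ⟨j, rfl⟩ := (hlr a).mp (hd a _ h.symm)
      rcases (hCadj i j).mp h with rfl | rfl
      · exact Or.inr (Or.inr (Or.inl ⟨i, rfl, rfl, hφC i⟩))
      · refine Or.inr (Or.inr (Or.inr ⟨j, rfl, rfl, ?_⟩))
        rw [Sym2.eq_swap]
        exact hφC j
  have hfL : ∀ i, f i ∈ LL s(l i, l (i + 1)) := fun i => (Finset.mem_sdiff.mp (hf i).1).1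
  have hcL : ∀ v, v ≠ R.r → c v ∈ LL s(v, R.par v) := by
    intro v hv
    have h1 := (hV v hv).1
    simpa only [if_neg hv] using h1
  refine ⟨φ, ?_, local_check R n l hinj hrange _ c O f hV hcl (fun i => (hf i).2.1)
    (fun i => (hf i).2.2) hB _ φ hG⟩
  intro e he
  induction e using Sym2.ind with
  | _ b a =>
    rcases hG b a he with ⟨h1, rfl, h3⟩ | ⟨h1, rfl, h3⟩ | ⟨i, rfl, rfl, h3⟩ | ⟨i, rfl, rfl, h3⟩
    · rw [h3, Sym2.eq_swap]; exact hcL a h1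
    · rw [h3]; exact hcL b h1
    · rw [h3]; exact hfL i
    · rw [h3, Sym2.eq_swap]; exact hfL i
end
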